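/- Let X ⊂ ℝ² be a Suslinian continuum in the plane. If Y ⊂ X is almost zero-dimensional, then Y is zero-dimensional. -/

import Mathlib

open Set Filter Topology

/-- The Euclidean plane. -/
abbrev Plane := EuclideanSpace ℝ (Fin 2)

section Defs

variable {α : Type*} [TopologicalSpace α]

/-- `A` is an arc with endpoints `a` and `b`: a homeomorphic image of `[0,1]`
sending `0 ↦ a` and `1 ↦ b`. -/
def IsArcWithEndpoints (A : Set α) (a b : α) : Prop :=
  ∃ f : ℝ → α, ContinuousOn f (Set.Icc 0 1) ∧ Set.InjOn f (Set.Icc 0 1) ∧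
    f '' (Set.Icc 0 1) = A ∧ f 0 = a ∧ f 1 = b

/-- `A` is an arc. -/
def IsArc (A : Set α) : Prop := ∃ a b, IsArcWithEndpoints A a b

/-- Every two distinct points of `X` are joined by an arc inside `X`. -/
def ArcwiseConnected (X : Set α) : Prop :=
  ∀ x ∈ X, ∀ y ∈ X, x ≠ y → ∃ A, A ⊆ X ∧ IsArcWithEndpoints A x y

/-- Every two subcontinua of `X` have connected intersection. -/
def HereditarilyUnicoherent (X : Set α) : Prop :=
  ∀ K L : Set α, K ⊆ X → L ⊆ X → IsCompact K → IsConnected K →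
    IsCompact L → IsConnected L → IsPreconnected (K ∩ L)

/-- A dendroid: a hereditarily unicoherent, arcwise connected continuum. -/
def IsDendroid (X : Set α) : Prop :=
  IsCompact X ∧ IsConnected X ∧ HereditarilyUnicoherent X ∧ ArcwiseConnected X

/-- The set of endpoints of `X`: points that are endpoints of every arc in `X`
containing them. -/
def Endpoints (X : Set α) : Set α :=
  {e | e ∈ X ∧ ∀ A : Set α, A ⊆ X → IsArc A → e ∈ A → ∃ b, IsArcWithEndpoints A e b}

/-- `X` is Suslinian: every collection of pairwise-disjoint non-degenerate
subcontinua of `X` is countable. -/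
def IsSuslinian (X : Set α) : Prop :=
  ∀ S : Set (Set α), (∀ K ∈ S, K ⊆ X ∧ IsCompact K ∧ IsConnected K ∧ K.Nontrivial) →
    S.PairwiseDisjoint id → S.Countable

/-- The arc component of `x` inside the set `S`. -/
def arcComponentIn (S : Set α) (x : α) : Set α :=
  {y | y ∈ S ∧ (y = x ∨ ∃ A, A ⊆ S ∧ IsArcWithEndpoints A x y)}

/-- The collection of arc components of `X \ {x}`; its cardinality is the order of `x`. -/
def orderComponents (X : Set α) (x : α) : Set (Set α) :=
  {C | ∃ y ∈ X \ {x}, C = arcComponentIn (X \ {x}) y}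

/-- Ramification points of `X`: points of order at least 3. -/
def RamificationPoints (X : Set α) : Set α :=
  {x | x ∈ X ∧ 3 ≤ (orderComponents X x).encard}

/-- `A` is a clopen subset of the subspace `Y`. -/
def IsClopenIn (Y A : Set α) : Prop :=
  A ⊆ Y ∧ (∃ U, IsOpen U ∧ A = Y ∩ U) ∧ (∃ C, IsClosed C ∧ A = Y ∩ C)

/-- The quasicomponent of `x` in the subspace `Y`: the intersection of all
clopen subsets of `Y` containing `x`. -/
def quasicomponentIn (Y : Set α) (x : α) : Set α :=
  {y ∈ Y | ∀ A : Set α, IsClopenIn Y A → x ∈ A → y ∈ A}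

/-- `Y` is hereditarily disconnected: it contains no non-degenerate connected subset. -/
def HereditarilyDisconnected (Y : Set α) : Prop :=
  ∀ S : Set α, S ⊆ Y → IsPreconnected S → S.Subsingleton

end Defs

/-- The point `x` of `X` is (arcwise) accessible from `ℝ² \ X`. -/
def AccessiblePoint (X : Set Plane) (x : Plane) : Prop :=
  ∃ A : Set Plane, IsArc A ∧ A ∩ X = {x}

/-- `σ` separates the points `b` and `d` in the plane: no connected subset of the
complement of `σ` contains both. -/
def SeparatesPoints (σ : Set Plane) (b d : Plane) : Prop :=
  b ∉ σ ∧ d ∉ σ ∧ ∀ K : Set Plane, K ⊆ σᶜ → IsPreconnected K → b ∈ K → d ∉ K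

/-- A simple closed curve in the plane: the image of a period-1 parametrization
injective on `[0,1)`. -/
def IsSimpleClosedCurve (O : Set Plane) : Prop :=
  ∃ f : ℝ → Plane, Continuous f ∧ Function.Periodic f 1 ∧
    Set.InjOn f (Set.Ico 0 1) ∧ f '' (Set.Ico 0 1) = O

/-- The dendroid `X` is smooth at `p`: there is a choice `arcTo x` of the unique arc
from `x` to `p` (reduced to `{p}` for `x = p`) such that `xₙ → x` in `X` implies
`arcTo xₙ → arcTo x` in the Hausdorff distance. -/
def DendroidSmoothAt (X : Set Plane) (p : Plane) : Prop :=
  p ∈ X ∧ ∃ arcTo : Plane → Set Plane,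
    arcTo p = {p} ∧
    (∀ x ∈ X, x ≠ p → arcTo x ⊆ X ∧ IsArcWithEndpoints (arcTo x) x p) ∧
    (∀ (xs : ℕ → Plane) (x : Plane), (∀ n, xs n ∈ X) → x ∈ X →
      Filter.Tendsto xs Filter.atTop (nhds x) →
      Filter.Tendsto (fun n => EMetric.hausdorffEdist (arcTo (xs n)) (arcTo x))
        Filter.atTop (nhds 0))

/-- A space is zero-dimensional if it has a basis of clopen sets. -/
def IsZeroDimensionalSpace (β : Type*) [TopologicalSpace β] : Prop :=
  ∀ (x : β) (U : Set β), IsOpen U → x ∈ U → ∃ V : Set β, IsClopen V ∧ x ∈ V ∧ V ⊆ U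

/-- A space is almost zero-dimensional if it has a neighborhood basis of sets
which are intersections of clopen sets. -/
def IsAlmostZeroDimensionalSpace (β : Type*) [TopologicalSpace β] : Prop :=
  ∀ (x : β) (U : Set β), IsOpen U → x ∈ U →
    ∃ V : Set β, V ∈ nhds x ∧ V ⊆ U ∧
      ∃ 𝒞 : Set (Set β), (∀ C ∈ 𝒞, IsClopen C) ∧ V = ⋂₀ 𝒞

/-- The union of `W` with all of the bounded connected components of its complement. -/
def boundedComplementaryFill (W : Set Plane) : Set Plane :=
  W ∪ ⋃₀ {K | (∃ x ∈ Wᶜ, K = connectedComponentIn Wᶜ x) ∧ Bornology.IsBounded K}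

/-- A Bellamy dendroid: a (non-degenerate) smooth plane dendroid whose endpoint
set is connected. -/
def IsBellamyDendroid (K : Set Plane) : Prop :=
  IsDendroid K ∧ K.Nontrivial ∧ (∃ q, DendroidSmoothAt K q) ∧ IsConnected (Endpoints K)

/-- The middle-thirds Cantor set. -/
noncomputable def cantorC : Set ℝ :=
  {x | ∃ a : ℕ → Bool, x = ∑' i, (if a i then (2 : ℝ) else 0) / 3 ^ (i + 1)}

section AlmostZeroDimensional

variable {β : Type*} [TopologicalSpace β]

lemma exists_isClopen_mem_disjoint_sInter {𝒞 : Set (Set β)} (h𝒞 : ∀ C ∈ 𝒞, IsClopen C) {p : β}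
    (hp : p ∉ ⋂₀ 𝒞) : ∃ E, IsClopen E ∧ p ∈ E ∧ Disjoint E (⋂₀ 𝒞) := by
  simp only [mem_sInter, not_forall] at hp
  obtain ⟨C, hC, hpC⟩ := hp
  refine ⟨Cᶜ, (h𝒞 C hC).compl, hpC, ?_⟩
  rw [Set.disjoint_left]
  exact fun z hz hz' => hz (hz' C hC)

/-- In an almost zero-dimensional space, a countable closed set can be separated from a point
outside it by a clopen set. -/
lemma IsAlmostZeroDimensionalSpace.exists_isClopen_of_countable [SecondCountableTopology β]
    (h : IsAlmostZeroDimensionalSpace β) {B : Set β} (hBc : IsClosed B) (hB : B.Countable)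
    {x : β} (hx : x ∉ B) : ∃ E, IsClopen E ∧ B ⊆ E ∧ x ∉ E := by
  have h1 : ∀ y, ∃ A : Set β, y ∉ B → (A ∈ 𝓝 y ∧
      ∀ p ∈ B, ∃ E, IsClopen E ∧ p ∈ E ∧ Disjoint E A) := by
    intro y
    by_cases hy : y ∈ B
    · exact ⟨∅, fun h => (h hy).elim⟩
    obtain ⟨A, hA, hAB, 𝒞, h𝒞, rfl⟩ := h y Bᶜ hBc.isOpen_compl hy
    exact ⟨_, fun _ => ⟨hA, fun p hp =>
      exists_isClopen_mem_disjoint_sInter h𝒞 (fun hp' => hAB hp' hp)⟩⟩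
  choose A hA using h1
  obtain ⟨t, htB, htc, hcov⟩ := TopologicalSpace.countable_cover_nhdsWithin (s := Bᶜ)
    (f := fun y => interior (A y))
    (fun y hy => mem_nhdsWithin_of_mem_nhds (interior_mem_nhds.2 (hA y hy).1))
  have htne : t.Nonempty := by
    have := hcov hx
    simp only [mem_iUnion] at this
    obtain ⟨y, hy, -⟩ := this
    exact ⟨y, hy⟩
  obtain ⟨g, rfl⟩ := htc.exists_eq_range htne
  rcases B.eq_empty_or_nonempty with rfl | hBne
  · exact ⟨∅, isClopen_empty, le_rfl, notMem_empty _⟩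
  obtain ⟨p, rfl⟩ := hB.exists_eq_range hBne
  have hg : ∀ n, g n ∉ range p := fun n => htB (mem_range_self n)
  have h2 : ∀ i, ∃ E, IsClopen E ∧ p i ∈ E ∧ x ∉ E ∧ ∀ j ≤ i, Disjoint E (A (g j)) := by
    intro i
    choose F hF hpF hFA using fun j => (hA (g j) (hg j)).2 (p i) (mem_range_self i)
    obtain ⟨F', hF', hpF', hFA'⟩ := (hA x hx).2 (p i) (mem_range_self i)
    refine ⟨F' ∩ ⋂ j ∈ Finset.range (i + 1), F j,
      hF'.inter (isClopen_biInter_finset fun j _ => hF j), ⟨hpF', ?_⟩, ?_, ?_⟩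
    · exact mem_iInter₂.2 fun j _ => hpF j
    · exact fun hxE => Set.disjoint_left.1 hFA' hxE.1 (mem_of_mem_nhds (hA x hx).1)
    · intro j hj
      refine (hFA j).mono_left fun z hz => ?_
      exact mem_iInter₂.1 hz.2 j (Finset.mem_range.2 (Nat.lt_succ_of_le hj))
  choose E hE hpE hxE hEA using h2
  refine ⟨⋃ i, E i, ⟨?_, isOpen_iUnion fun i => (hE i).isOpen⟩, ?_, ?_⟩
  · rw [← isOpen_compl_iff, isOpen_iff_mem_nhds]
    intro y hy
    have hyB : y ∈ (range p)ᶜ := by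
      rintro ⟨i, rfl⟩
      exact hy (mem_iUnion.2 ⟨i, hpE i⟩)
    have := hcov hyB
    simp only [mem_iUnion, mem_range, exists_prop, exists_exists_eq_and] at this
    obtain ⟨n, hn⟩ := this
    have hopen : IsOpen (interior (A (g n)) ∩ ⋂ i ∈ Finset.range n, (E i)ᶜ) :=
      isOpen_interior.inter (isClopen_biInter_finset fun i _ => (hE i).compl).isOpen
    refine Filter.mem_of_superset (hopen.mem_nhds ⟨hn, ?_⟩) ?_
    · exact mem_iInter₂.2 fun i _ hi => hy (mem_iUnion.2 ⟨i, hi⟩)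
    · rintro z ⟨hz, hz'⟩ hzE
      obtain ⟨i, hi⟩ := mem_iUnion.1 hzE
      rcases lt_or_ge i n with hin | hin
      · exact mem_iInter₂.1 hz' i (Finset.mem_range.2 hin) hi
      · exact Set.disjoint_left.1 (hEA i n hin) hi (interior_subset hz)
  · rintro _ ⟨i, rfl⟩
    exact mem_iUnion.2 ⟨i, hpE i⟩
  · rw [mem_iUnion]
    rintro ⟨i, hi⟩
    exact hxE i hi

/-- An almost zero-dimensional space which is zero-dimensional at all but countably many points
is zero-dimensional. -/
lemma IsAlmostZeroDimensionalSpace.isZeroDimensionalSpace_of_countable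
    [SecondCountableTopology β] [RegularSpace β] (h : IsAlmostZeroDimensionalSpace β)
    (hbad : {x : β | ∃ U, IsOpen U ∧ x ∈ U ∧ ∀ V, IsClopen V → x ∈ V → ¬ V ⊆ U}.Countable) :
    IsZeroDimensionalSpace β := by
  intro x U hU hxU
  obtain ⟨C, hC, hCc, hCU⟩ := exists_mem_nhds_isClosed_subset (hU.mem_nhds hxU)
  obtain ⟨W, hWC, hW, hxW⟩ := mem_nhds_iff.1 hC
  set 𝒱 : Set (Set β) := {V | IsClopen V ∧ (V ⊆ U ∨ Disjoint V W)} with h𝒱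
  obtain ⟨T, hTc, hT𝒱, hTU⟩ := TopologicalSpace.isOpen_sUnion_countable 𝒱 (fun V hV => hV.1.isOpen)
  obtain ⟨V, hV⟩ := (hTc.insert ∅).exists_eq_range (insert_nonempty _ _)
  have hVmem : ∀ n, V n ∈ 𝒱 := by
    intro n
    have : V n ∈ insert ∅ T := hV ▸ mem_range_self n
    rcases this with h | h
    · rw [h]
      exact ⟨isClopen_empty, Or.inl (empty_subset _)⟩
    · exact hT𝒱 h
  have hVU : ⋃ n, V n = ⋃₀ 𝒱 := by
    rw [← hTU, ← sUnion_range, ← hV, sUnion_insert, empty_union]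
  set P : Set β := (⋃ n, V n)ᶜ with hP
  have hPclosed : IsClosed P := (isOpen_iUnion fun n => (hVmem n).1.isOpen).isClosed_compl
  have hPcount : P.Countable := by
    refine hbad.mono fun y hy => ?_
    rw [hP, hVU] at hy
    by_contra hgood
    simp only [mem_ofPred_eq, not_exists, not_and, not_forall, not_not] at hgood
    by_cases hyU : y ∈ U
    · obtain ⟨A, hA, hyA, hAU⟩ := hgood U hU hyU
      exact hy ⟨A, ⟨hA, Or.inl hAU⟩, hyA⟩
    · obtain ⟨A, hA, hyA, hAC⟩ := hgood Cᶜ hCc.isOpen_compl (fun hyC => hyU (hCU hyC))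
      exact hy ⟨A, ⟨hA, Or.inr (Set.disjoint_left.2 fun z hz hzW => hAC hz (hWC hzW))⟩, hyA⟩
  obtain ⟨E, hE, hBE, hxE⟩ := h.exists_isClopen_of_countable (hPclosed.sdiff hW)
    (hPcount.mono sdiff_subset) (x := x) (fun hx => hx.2 hxW)
  have hDclopen : ∀ n, IsClopen (disjointed V n) := by
    intro n
    rw [disjointed_eq_inter_compl]
    exact (hVmem n).1.inter ((finite_lt_nat n).isClopen_biInter fun i _ => (hVmem i).1.compl)
  have hDV : ∀ n, disjointed V n ⊆ V n := fun n => disjointed_subset V n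
  have hcover : ∀ y, y ∈ P ∨ ∃ n, y ∈ disjointed V n := by
    intro y
    by_cases hy : y ∈ P
    · exact Or.inl hy
    · rw [hP, ← iUnion_disjointed, notMem_compl_iff, mem_iUnion] at hy
      exact Or.inr hy
  set G : Set β := {y | ∃ n, y ∈ disjointed V n ∧ V n ⊆ U} with hG
  set N : Set β := {y | ∃ n, y ∈ disjointed V n ∧ ¬ V n ⊆ U} with hN
  have hGo : IsOpen G := by
    have : G = ⋃ n, ⋃ _ : V n ⊆ U, disjointed V n := by
      ext y; simp [hG, and_comm]
    rw [this]
    exact isOpen_iUnion fun n => isOpen_iUnion fun _ => (hDclopen n).isOpen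
  have hNo : IsOpen N := by
    have : N = ⋃ n, ⋃ _ : ¬ V n ⊆ U, disjointed V n := by
      ext y; simp [hN, and_comm]
    rw [this]
    exact isOpen_iUnion fun n => isOpen_iUnion fun _ => (hDclopen n).isOpen
  have hNW : Disjoint N W := by
    rw [Set.disjoint_left]
    rintro y ⟨n, hyn, hn⟩ hyW
    exact Set.disjoint_left.1 ((hVmem n).2.resolve_left hn) (hDV n hyn) hyW
  have hcases : ∀ y, y ∉ N → y ∈ P ∪ G := by
    intro y hy
    rcases hcover y with h | ⟨n, hn⟩
    · exact Or.inl h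
    · by_cases hVn : V n ⊆ U
      · exact Or.inr ⟨n, hn, hVn⟩
      · exact (hy ⟨n, hn, hVn⟩).elim
  have hGN : Disjoint G N := by
    rw [Set.disjoint_left]
    rintro y ⟨n, hyn, hn⟩ ⟨m, hym, hm⟩
    by_cases hnm : n = m
    · exact hm (hnm ▸ hn)
    · exact Set.disjoint_left.1 (disjoint_disjointed V hnm) hyn hym
  have hPN : Disjoint P N := by
    rw [Set.disjoint_left]
    rintro y hy ⟨m, hym, -⟩
    exact hy (mem_iUnion.2 ⟨m, hDV m hym⟩)
  have hPW : ∀ y ∈ P, y ∉ E → y ∈ W := fun y hy hyE => by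
    by_contra hyW
    exact hyE (hBE ⟨hy, hyW⟩)
  refine ⟨Eᶜ \ N, ⟨hE.compl.isClosed.sdiff hNo, ?_⟩, ⟨hxE, fun hxN => ?_⟩, ?_⟩
  · have : Eᶜ \ N = Eᶜ ∩ (W ∪ G) := by
      ext y
      constructor
      · rintro ⟨hyE, hyN⟩
        refine ⟨hyE, ?_⟩
        rcases hcases y hyN with h | h
        · exact Or.inl (hPW y h hyE)
        · exact Or.inr h
      · rintro ⟨hyE, hy | hy⟩
        · exact ⟨hyE, fun h => Set.disjoint_left.1 hNW h hy⟩
        · exact ⟨hyE, Set.disjoint_left.1 hGN hy⟩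
    rw [this]
    exact hE.compl.isOpen.inter (hW.union hGo)
  · exact Set.disjoint_left.1 hNW hxN hxW
  · rintro y ⟨hyE, hyN⟩
    rcases hcases y hyN with h | ⟨n, hn, hnU⟩
    · exact hCU (hWC (hPW y h hyE))
    · exact hnU (hDV n hn)

end AlmostZeroDimensional

section HalfPlane

lemma exists_int_of_sin_nonneg {θ : ℝ → ℝ} (hθ : Continuous θ) (h : ∀ t, 0 ≤ Real.sin (θ t)) :
    ∃ k : ℤ, ∀ t, 2 * k * Real.pi ≤ θ t ∧ θ t ≤ (2 * k + 1) * Real.pi := by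
  have key : ∀ (k : ℤ) (r : ℝ), (2 * k - 1) * Real.pi < r → r < 2 * k * Real.pi →
      Real.sin r < 0 := by
    intro k r h1 h2
    have : Real.sin (r - k * (2 * Real.pi)) < 0 :=
      Real.sin_neg_of_neg_of_neg_pi_lt (by linarith) (by linarith)
    rwa [Real.sin_sub_int_mul_two_pi] at this
  have hpi := Real.pi_pos
  have hk1 := Int.floor_le (θ 0 / (2 * Real.pi))
  have hk2 := Int.lt_floor_add_one (θ 0 / (2 * Real.pi))
  set k := ⌊θ 0 / (2 * Real.pi)⌋
  rw [le_div_iff₀ (by positivity)] at hk1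
  rw [div_lt_iff₀ (by positivity)] at hk2
  have hord : OrdConnected (range θ) := (isPreconnected_range hθ).ordConnected
  have hrange : ∀ r ∈ range θ, 0 ≤ Real.sin r := by
    rintro _ ⟨t, rfl⟩
    exact h t
  refine ⟨k, fun t => ⟨?_, ?_⟩⟩
  · by_contra! hlt
    set m := max (θ t) (2 * k * Real.pi - Real.pi / 2) with hm
    have hm1 : m < 2 * k * Real.pi := max_lt hlt (by linarith)
    have := key k m (lt_of_lt_of_le (by linarith) (le_max_right _ _)) hm1
    exact this.not_ge (hrange m (hord.out (mem_range_self t) (mem_range_self 0)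
      ⟨le_max_left _ _, by linarith⟩))
  · by_contra! hlt
    have h0 : θ 0 ≤ (2 * k + 1) * Real.pi := by
      by_contra! h0
      exact (key (k + 1) (θ 0) (by push_cast; linarith) (by push_cast; linarith)).not_ge (h 0)
    set m := min (θ t) (2 * k * Real.pi + 3 * Real.pi / 2) with hm
    have hm1 : (2 * k + 1) * Real.pi < m := lt_min hlt (by linarith)
    have := key (k + 1) m (by push_cast; linarith)
      (lt_of_le_of_lt (min_le_right _ _) (by push_cast; linarith))
    exact this.not_ge (hrange m (hord.out (mem_range_self 0) (mem_range_self t)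
      ⟨by linarith, min_le_left _ _⟩))

lemma eq_of_sin_eq_zero_of_cos_pos {k : ℤ} {r : ℝ} (h1 : 2 * k * Real.pi ≤ r)
    (h2 : r ≤ (2 * k + 1) * Real.pi) (hs : Real.sin r = 0) (hc : 0 < Real.cos r) :
    r = 2 * k * Real.pi := by
  have hs' : Real.sin (r - k * (2 * Real.pi)) = 0 := by rwa [Real.sin_sub_int_mul_two_pi]
  have hc' : 0 < Real.cos (r - k * (2 * Real.pi)) := by rwa [Real.cos_sub_int_mul_two_pi]
  have hlt : r - k * (2 * Real.pi) < Real.pi := by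
    refine lt_of_le_of_ne (by linarith) fun h => ?_
    rw [h, Real.cos_pi] at hc'
    linarith
  have := (Real.sin_eq_zero_iff_of_lt_of_lt (by linarith [Real.pi_pos]) hlt).1 hs'
  linarith

lemma eq_of_sin_eq_zero_of_cos_neg {k : ℤ} {r : ℝ} (h1 : 2 * k * Real.pi ≤ r)
    (h2 : r ≤ (2 * k + 1) * Real.pi) (hs : Real.sin r = 0) (hc : Real.cos r < 0) :
    r = (2 * k + 1) * Real.pi := by
  have hs' : Real.sin ((2 * k + 1) * Real.pi - r) = 0 := by
    rw [show (2 * k + 1) * Real.pi - r = Real.pi - r + k * (2 * Real.pi) by ring,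
      Real.sin_add_int_mul_two_pi, Real.sin_pi_sub, hs]
  have hc' : 0 < Real.cos ((2 * k + 1) * Real.pi - r) := by
    rw [show (2 * k + 1) * Real.pi - r = Real.pi - r + k * (2 * Real.pi) by ring,
      Real.cos_add_int_mul_two_pi, Real.cos_pi_sub]
    linarith
  have hlt : (2 * k + 1) * Real.pi - r < Real.pi := by
    refine lt_of_le_of_ne (by linarith) fun h => ?_
    rw [h, Real.cos_pi] at hc'
    linarith
  have := (Real.sin_eq_zero_iff_of_lt_of_lt (by linarith [Real.pi_pos]) hlt).1 hs'
  linarith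

/-- Two paths in the closed upper half plane whose endpoints interlace on the real line
intersect. -/
lemma exists_eq_of_paths_upperHalfPlane {a b c d : ℝ} (hab : a < b) (hbc : b < c) (hcd : c < d)
    (f : Path (a : ℂ) c) (g : Path (b : ℂ) d) (hf : ∀ t, 0 ≤ (f t).im) (hg : ∀ t, 0 ≤ (g t).im) :
    ∃ s t, f s = g t := by
  by_contra! hne
  have hfe : ∀ s : ℝ, ∃ s', f.extend s = f s' := fun s => ⟨_, rfl⟩
  have hge : ∀ s : ℝ, ∃ s', g.extend s = g s' := fun s => ⟨_, rfl⟩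
  have hfim : ∀ s : ℝ, 0 ≤ (f.extend s).im := fun s => by
    obtain ⟨s', hs'⟩ := hfe s
    rw [hs']
    exact hf s'
  have hgim : ∀ s : ℝ, 0 ≤ (g.extend s).im := fun s => by
    obtain ⟨s', hs'⟩ := hge s
    rw [hs']
    exact hg s'
  let h : C(ℝ × ℝ, ℂ) := ⟨fun p => f.extend p.1 - g.extend p.2, by fun_prop⟩
  have hh : ∀ p, h p ∈ ({0}ᶜ : Set ℂ) := by
    rintro ⟨s, t⟩ h0
    obtain ⟨s', hs'⟩ := hfe s
    obtain ⟨t', ht'⟩ := hge t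
    apply hne s' t'
    rw [← hs', ← ht']
    exact sub_eq_zero.1 h0
  obtain ⟨φ, ⟨-, hφ⟩, -⟩ := Complex.isCoveringMapOn_exp.existsUnique_continuousMap_lifts h
    (a₀ := (0, 0)) (e₀ := Complex.log (h (0, 0))) (Complex.exp_log (hh _)) hh
  have hφ' : ∀ s t : ℝ, Complex.exp (φ (s, t)) = f.extend s - g.extend t :=
    fun s t => congrFun hφ (s, t)
  have hre : ∀ s t : ℝ, Real.exp (φ (s, t)).re * Real.cos (φ (s, t)).im =
      (f.extend s).re - (g.extend t).re := fun s t => by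
    rw [← Complex.exp_re, hφ', Complex.sub_re]
  have him : ∀ s t : ℝ, Real.exp (φ (s, t)).re * Real.sin (φ (s, t)).im =
      (f.extend s).im - (g.extend t).im := fun s t => by
    rw [← Complex.exp_im, hφ', Complex.sub_im]
  have hsin_nonneg : ∀ s t : ℝ, 0 ≤ (f.extend s).im - (g.extend t).im →
      0 ≤ Real.sin (φ (s, t)).im := fun s t h => by
    rw [← him] at h
    exact nonneg_of_mul_nonneg_right h (Real.exp_pos _)
  have hsin_nonpos : ∀ s t : ℝ, (f.extend s).im - (g.extend t).im ≤ 0 →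
      0 ≤ Real.sin ((φ (s, t)).im + Real.pi) := fun s t h => by
    rw [← him] at h
    rw [Real.sin_add_pi, neg_nonneg]
    exact nonpos_of_mul_nonpos_right h (Real.exp_pos _)
  have hsin_zero : ∀ s t : ℝ, (f.extend s).im - (g.extend t).im = 0 →
      Real.sin (φ (s, t)).im = 0 := fun s t h => by
    rw [← him] at h
    exact (mul_eq_zero.1 h).resolve_left (Real.exp_pos _).ne'
  have hcos_pos : ∀ s t : ℝ, 0 < (f.extend s).re - (g.extend t).re →
      0 < Real.cos (φ (s, t)).im := fun s t h => by
    rw [← hre] at h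
    exact pos_of_mul_pos_right h (Real.exp_pos _).le
  have hcos_neg : ∀ s t : ℝ, (f.extend s).re - (g.extend t).re < 0 →
      Real.cos (φ (s, t)).im < 0 := fun s t h => by
    rw [← hre] at h
    exact neg_of_mul_neg_right h (Real.exp_pos _).le
  have hs00 : Real.sin (φ (0, 0)).im = 0 := hsin_zero 0 0 (by simp)
  have hs01 : Real.sin (φ (0, 1)).im = 0 := hsin_zero 0 1 (by simp)
  have hs11 : Real.sin (φ (1, 1)).im = 0 := hsin_zero 1 1 (by simp)
  have hs10 : Real.sin (φ (1, 0)).im = 0 := hsin_zero 1 0 (by simp)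
  have hc00 : Real.cos (φ (0, 0)).im < 0 := hcos_neg 0 0 (by simpa using hab)
  have hc01 : Real.cos (φ (0, 1)).im < 0 := hcos_neg 0 1 (by simpa using by linarith)
  have hc11 : Real.cos (φ (1, 1)).im < 0 := hcos_neg 1 1 (by simpa using hcd)
  have hc10 : 0 < Real.cos (φ (1, 0)).im := hcos_pos 1 0 (by simpa using hbc)
  have shift : ∀ r : ℝ, Real.sin r = 0 → Real.sin (r + Real.pi) = 0 := fun r h => by
    rw [Real.sin_add_pi, h, neg_zero]
  have left : (φ (0, 0)).im = (φ (0, 1)).im := by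
    obtain ⟨k, hk⟩ := exists_int_of_sin_nonneg (θ := fun t => (φ (0, t)).im + Real.pi)
      (by fun_prop) (fun t => hsin_nonpos 0 t (by simpa using hgim t))
    have h0 := eq_of_sin_eq_zero_of_cos_pos (hk 0).1 (hk 0).2 (shift _ hs00)
      (by rw [Real.cos_add_pi]; linarith)
    have h1 := eq_of_sin_eq_zero_of_cos_pos (hk 1).1 (hk 1).2 (shift _ hs01)
      (by rw [Real.cos_add_pi]; linarith)
    linarith
  have top : (φ (0, 1)).im = (φ (1, 1)).im := by
    obtain ⟨k, hk⟩ := exists_int_of_sin_nonneg (θ := fun t => (φ (t, 1)).im)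
      (by fun_prop) (fun t => hsin_nonneg t 1 (by simpa using hfim t))
    have h0 := eq_of_sin_eq_zero_of_cos_neg (hk 0).1 (hk 0).2 hs01 hc01
    have h1 := eq_of_sin_eq_zero_of_cos_neg (hk 1).1 (hk 1).2 hs11 hc11
    linarith
  have right : (φ (1, 0)).im = (φ (1, 1)).im + Real.pi := by
    obtain ⟨k, hk⟩ := exists_int_of_sin_nonneg (θ := fun t => (φ (1, t)).im + Real.pi)
      (by fun_prop) (fun t => hsin_nonpos 1 t (by simpa using hgim t))
    have h0 := eq_of_sin_eq_zero_of_cos_neg (hk 0).1 (hk 0).2 (shift _ hs10)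
      (by rw [Real.cos_add_pi]; linarith)
    have h1 := eq_of_sin_eq_zero_of_cos_pos (hk 1).1 (hk 1).2 (shift _ hs11)
      (by rw [Real.cos_add_pi]; linarith)
    linarith
  have bottom : (φ (0, 0)).im = (φ (1, 0)).im + Real.pi := by
    obtain ⟨k, hk⟩ := exists_int_of_sin_nonneg (θ := fun t => (φ (t, 0)).im)
      (by fun_prop) (fun t => hsin_nonneg t 0 (by simpa using hfim t))
    have h0 := eq_of_sin_eq_zero_of_cos_neg (hk 0).1 (hk 0).2 hs00 hc00
    have h1 := eq_of_sin_eq_zero_of_cos_pos (hk 1).1 (hk 1).2 hs10 hc10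
    linarith
  linarith [Real.pi_pos]

end HalfPlane

section Disc

lemma exists_norm_eq_notMem_range {r : ℝ} (hr : 0 < r) (v : Fin 4 → ℂ) :
    ∃ ζ : ℂ, ‖ζ‖ = r ∧ ∀ i, v i ≠ ζ := by
  have hinf : (Metric.sphere (0 : ℂ) r).Infinite := by
    refine (isPreconnected_sphere (by simp) 0 r).infinite_of_nontrivial
      ⟨(r : ℂ), by simp [abs_of_pos hr], -(r : ℂ), by simp [abs_of_pos hr], ?_⟩
    intro h
    have := congrArg Complex.re h
    simp only [Complex.ofReal_re, Complex.neg_re] at this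
    linarith
  obtain ⟨ζ, hζ, hζv⟩ := hinf.exists_notMem_finite (finite_range v)
  exact ⟨ζ, by simpa using hζ, fun i hi => hζv ⟨i, hi⟩⟩

/-- The Möbius transformation sending the disc with `ζ` on its boundary to the upper half plane
and `ζ` to infinity. -/
noncomputable def discToHalfPlane (ζ z : ℂ) : ℂ := Complex.I * ((ζ + z) / (ζ - z))

lemma discToHalfPlane_im (ζ z : ℂ) :
    (discToHalfPlane ζ z).im = (‖ζ‖ ^ 2 - ‖z‖ ^ 2) / Complex.normSq (ζ - z) := by
  rw [discToHalfPlane, Complex.I_mul_im, Complex.div_re, ← Complex.normSq_eq_norm_sq,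
    ← Complex.normSq_eq_norm_sq, ← add_div]
  congr 1
  simp [Complex.normSq_apply]
  ring

lemma discToHalfPlane_injOn {ζ : ℂ} (hζ : ζ ≠ 0) : InjOn (discToHalfPlane ζ) {ζ}ᶜ := by
  intro z hz w hw h
  have hz' : ζ - z ≠ 0 := sub_ne_zero.2 (Ne.symm hz)
  have hw' : ζ - w ≠ 0 := sub_ne_zero.2 (Ne.symm hw)
  have h1 := mul_left_cancel₀ Complex.I_ne_zero h
  rw [div_eq_div_iff hz' hw'] at h1
  have h2 : 2 * ζ * (z - w) = 0 := by linear_combination h1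
  exact sub_eq_zero.1 ((mul_eq_zero.1 h2).resolve_left (mul_ne_zero two_ne_zero hζ))

lemma discToHalfPlane_continuousOn (ζ : ℂ) : ContinuousOn (discToHalfPlane ζ) {ζ}ᶜ := by
  unfold discToHalfPlane
  refine ContinuousOn.mul continuousOn_const (ContinuousOn.div (by fun_prop) (by fun_prop) ?_)
  exact fun z hz => sub_ne_zero.2 (Ne.symm hz)

/-- Two paths in a disc of the complex plane whose endpoints interlace on the bounding circle
intersect. -/
lemma exists_perm_not_disjoint_of_joinedIn_complex {R : ℝ} (hR : 0 < R) {θ : Fin 4 → ℂ}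
    (hθ : Function.Injective θ) (hθR : ∀ i, ‖θ i‖ = R) :
    ∃ σ : Equiv.Perm (Fin 4), ∀ F G : Set ℂ, (∀ z ∈ F, ‖z‖ ≤ R) → (∀ z ∈ G, ‖z‖ ≤ R) →
      JoinedIn F (θ (σ 0)) (θ (σ 2)) → JoinedIn G (θ (σ 1)) (θ (σ 3)) → ¬ Disjoint F G := by
  obtain ⟨ζ, hζ, hζθ⟩ := exists_norm_eq_notMem_range (r := 2 * R) (by linarith)
    (fun i => (2 : ℝ) • θ i)
  have hζ0 : ζ ≠ 0 := by
    rintro rfl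
    rw [norm_zero] at hζ
    linarith
  set E : Fin 4 → Set ℂ := fun i => (fun t : ℝ => t • θ i) '' Icc 1 2 with hE
  have hEjoin : ∀ i, JoinedIn (E i) (θ i) ((2 : ℝ) • θ i) := by
    intro i
    have hpc : IsPathConnected (E i) :=
      ((convex_Icc (1 : ℝ) 2).isPathConnected ⟨1, by norm_num⟩).image (by fun_prop)
    exact hpc.joinedIn _ ⟨1, by norm_num⟩ _ ⟨2, by norm_num⟩
  have hnorm : ∀ i (t : ℝ), t ∈ Icc (1 : ℝ) 2 → ‖t • θ i‖ = t * R := by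
    intro i t ht
    rw [norm_smul, hθR, Real.norm_of_nonneg (by linarith [ht.1])]
  have hEle : ∀ i, ∀ z ∈ E i, ‖z‖ ≤ ‖ζ‖ := by
    rintro i _ ⟨t, ht, rfl⟩
    rw [hζ]
    refine (hnorm i t ht).le.trans ?_
    gcongr
    exact ht.2
  have hEζ : ∀ i, ζ ∉ E i := by
    rintro i ⟨t, ht, h⟩
    have h1 := hnorm i t ht
    rw [show t • θ i = ζ from h, hζ] at h1
    have : t = 2 := (mul_right_cancel₀ hR.ne' h1).symm
    exact hζθ i (this ▸ h)
  have hER : ∀ i, ∀ z ∈ E i, ‖z‖ ≤ R → z = θ i := by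
    rintro i _ ⟨t, ht, rfl⟩ hz
    have h1 : t * R ≤ R := (hnorm i t ht) ▸ hz
    have : t = 1 := le_antisymm (by by_contra! h; nlinarith) ht.1
    simp [this]
  have hEE : ∀ i j, i ≠ j → ∀ z ∈ E i, z ∉ E j := by
    rintro i j hij _ ⟨t, ht, rfl⟩ ⟨s, hs, h⟩
    have h1 := hnorm j s hs
    rw [show s • θ j = t • θ i from h, hnorm i t ht] at h1
    have hts : t = s := mul_right_cancel₀ hR.ne' h1
    subst hts
    have ht0 : t ≠ 0 := by linarith [ht.1]
    exact hij (hθ (smul_right_injective ℂ ht0 h)).symm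
  set T : Fin 4 → ℝ := fun i => (discToHalfPlane ζ ((2 : ℝ) • θ i)).re with hT
  have hTeq : ∀ i, ((T i : ℝ) : ℂ) = discToHalfPlane ζ ((2 : ℝ) • θ i) := by
    intro i
    apply Complex.ext
    · simp [hT]
    · rw [Complex.ofReal_im, discToHalfPlane_im, hζ, hnorm i 2 (by norm_num), sub_self, zero_div]
  have hTinj : Function.Injective T := by
    intro i j hij
    have h1 : discToHalfPlane ζ ((2 : ℝ) • θ i) = discToHalfPlane ζ ((2 : ℝ) • θ j) := by
      rw [← hTeq, ← hTeq, hij]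
    have h2 := discToHalfPlane_injOn hζ0 (hζθ i) (hζθ j) h1
    exact hθ (smul_right_injective ℂ (two_ne_zero (α := ℝ)) h2)
  have hmono : StrictMono (T ∘ Tuple.sort T) :=
    (Tuple.monotone_sort T).strictMono_of_injective (hTinj.comp (Tuple.sort T).injective)
  refine ⟨Tuple.sort T, fun F G hF hG hFj hGj hdisj => ?_⟩
  set σ := Tuple.sort T with hσ
  have extend : ∀ (F : Set ℂ) (i j : Fin 4), (∀ z ∈ F, ‖z‖ ≤ R) → JoinedIn F (θ i) (θ j) →
      ∃ γ : Path ((T i : ℝ) : ℂ) (T j), ∀ t, 0 ≤ (γ t).im ∧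
        ∃ z ∈ E i ∪ F ∪ E j, z ≠ ζ ∧ discToHalfPlane ζ z = γ t := by
    intro F i j hF hFj
    have h1 : JoinedIn (E i ∪ F ∪ E j) ((2 : ℝ) • θ i) ((2 : ℝ) • θ j) :=
      (((hEjoin i).symm.mono (by grind)).trans (hFj.mono (by grind))).trans
        ((hEjoin j).mono (by grind))
    have h2 : ∀ z ∈ E i ∪ F ∪ E j, z ≠ ζ ∧ ‖z‖ ≤ ‖ζ‖ := by
      rintro z ((hz | hz) | hz)
      · exact ⟨fun h => hEζ i (h ▸ hz), hEle i z hz⟩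
      · have := hF z hz
        refine ⟨?_, by linarith⟩
        rintro rfl
        linarith
      · exact ⟨fun h => hEζ j (h ▸ hz), hEle j z hz⟩
    have h3 := h1.map_continuousOn
      ((discToHalfPlane_continuousOn ζ).mono fun z hz => (h2 z hz).1)
    rw [← hTeq, ← hTeq] at h3
    obtain ⟨γ, hγ⟩ := h3
    refine ⟨γ, fun t => ?_⟩
    obtain ⟨z, hz, hzt⟩ := hγ t
    refine ⟨?_, z, hz, (h2 z hz).1, hzt⟩
    rw [← hzt, discToHalfPlane_im]
    have := (h2 z hz).2
    exact div_nonneg (by nlinarith [norm_nonneg z]) (Complex.normSq_nonneg _)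
  obtain ⟨f, hf⟩ := extend F _ _ hF hFj
  obtain ⟨g, hg⟩ := extend G _ _ hG hGj
  obtain ⟨s, t, hst⟩ := exists_eq_of_paths_upperHalfPlane
    (hmono (show (0 : Fin 4) < 1 by decide)) (hmono (show (1 : Fin 4) < 2 by decide))
    (hmono (show (2 : Fin 4) < 3 by decide)) f g (fun t => (hf t).1) (fun t => (hg t).1)
  obtain ⟨z, hz, hzζ, hzf⟩ := (hf s).2
  obtain ⟨w, hw, hwζ, hwg⟩ := (hg t).2
  have hzw : z = w := discToHalfPlane_injOn hζ0 hzζ hwζ (by rw [hzf, hwg, hst])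
  subst hzw
  have hne : ∀ i j : Fin 4, i ≠ j → σ i ≠ σ j := fun i j hij => σ.injective.ne hij
  have hFG : ∀ z ∈ F, z ∉ G := fun z hz hz' => Set.disjoint_left.1 hdisj hz hz'
  rcases hz with (hz | hz) | hz <;> rcases hw with (hw | hw) | hw
  · exact hEE _ _ (hne 0 1 (by decide)) z hz hw
  · exact hFG z (hER _ z hz (hG z hw) ▸ hFj.source_mem) hw
  · exact hEE _ _ (hne 0 3 (by decide)) z hz hw
  · exact hFG z hz (hER _ z hw (hF z hz) ▸ hGj.source_mem)
  · exact hFG z hz hw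
  · exact hFG z hz (hER _ z hw (hF z hz) ▸ hGj.target_mem)
  · exact hEE _ _ (hne 2 1 (by decide)) z hz hw
  · exact hFG z (hER _ z hz (hG z hw) ▸ hFj.target_mem) hw
  · exact hEE _ _ (hne 2 3 (by decide)) z hz hw

/-- Four points on a circle in the plane can be ordered so that paths in the disc joining the
first to the third and the second to the fourth intersect. -/
lemma exists_perm_not_disjoint_of_joinedIn {c : Plane} {R : ℝ} (hR : 0 < R) {θ : Fin 4 → Plane}
    (hθ : Function.Injective θ) (hθR : ∀ i, dist (θ i) c = R) :
    ∃ σ : Equiv.Perm (Fin 4), ∀ F G : Set Plane, F ⊆ Metric.closedBall c R →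
      G ⊆ Metric.closedBall c R → JoinedIn F (θ (σ 0)) (θ (σ 2)) →
      JoinedIn G (θ (σ 1)) (θ (σ 3)) → ¬ Disjoint F G := by
  let e : Plane → ℂ := fun z => Complex.orthonormalBasisOneI.repr.symm (z - c)
  have hec : Continuous e := by fun_prop
  have hei : Function.Injective e := fun z w h =>
    sub_left_injective (Complex.orthonormalBasisOneI.repr.symm.injective h)
  have hnorm : ∀ z, ‖e z‖ = dist z c := fun z => by
    rw [dist_eq_norm]
    exact LinearIsometryEquiv.norm_map _ _
  obtain ⟨σ, hσ⟩ := exists_perm_not_disjoint_of_joinedIn_complex hR (hei.comp hθ)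
    (fun i => (hnorm _).trans (hθR i))
  refine ⟨σ, fun F G hF hG hFj hGj hdisj => ?_⟩
  refine hσ (e '' F) (e '' G) ?_ ?_ (hFj.map_continuousOn hec.continuousOn)
    (hGj.map_continuousOn hec.continuousOn) ((disjoint_image_iff hei).2 hdisj)
  · rintro _ ⟨z, hz, rfl⟩
    exact (hnorm z).le.trans (hF hz)
  · rintro _ ⟨z, hz, rfl⟩
    exact (hnorm z).le.trans (hG hz)

end Disc

section Continua

variable {α : Type*} [TopologicalSpace α]

lemma exists_isClopen_of_notMem_connectedComponent [T2Space α] [CompactSpace α] {A B : Set α}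
    (hA : IsClosed A) (hB : IsClosed B) (h : ∀ a ∈ A, ∀ b ∈ B, b ∉ connectedComponent a) :
    ∃ V, IsClopen V ∧ A ⊆ V ∧ Disjoint V B := by
  have h1 : ∀ a, ∃ V, IsClopen V ∧ a ∈ V ∧ (a ∈ A → Disjoint V B) := by
    intro a
    by_cases ha : a ∈ A
    · have hne : Nonempty {s : Set α // IsClopen s ∧ a ∈ s} := ⟨⟨univ, isClopen_univ, mem_univ _⟩⟩
      obtain ⟨V, hV⟩ := hB.isCompact.elim_directed_family_closed
        (fun s : {s : Set α // IsClopen s ∧ a ∈ s} => (s : Set α)) (fun s => s.2.1.isClosed)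
        (by
          rw [← connectedComponent_eq_iInter_isClopen, eq_empty_iff_forall_notMem]
          exact fun b hb => h a ha b hb.1 hb.2)
        (fun s t => ⟨⟨s ∩ t, s.2.1.inter t.2.1, s.2.2, t.2.2⟩, inter_subset_left,
          inter_subset_right⟩)
      refine ⟨V, V.2.1, V.2.2, fun _ => ?_⟩
      rw [disjoint_iff_inter_eq_empty, inter_comm]
      exact hV
    · exact ⟨univ, isClopen_univ, mem_univ _, fun h => (ha h).elim⟩
  choose V hV haV hVB using h1
  obtain ⟨t, ht, hcov⟩ := hA.isCompact.elim_nhds_subcover V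
    (fun a _ => (hV a).isOpen.mem_nhds (haV a))
  refine ⟨⋃ a ∈ t, V a, isClopen_biUnion_finset fun a _ => hV a, hcov, ?_⟩
  simp only [disjoint_iUnion_left]
  exact fun a ha => hVB a (ht a ha)

/-- A compact set is either separated between two closed subsets, or contains a continuum meeting
both of them. -/
lemma IsCompact.exists_separation_or_continuum [T2Space α] {Z A B : Set α} (hZ : IsCompact Z)
    (hA : IsClosed A) (hB : IsClosed B) :
    (∃ Z₁ Z₂ : Set α, IsCompact Z₁ ∧ IsCompact Z₂ ∧ Disjoint Z₁ Z₂ ∧ Z = Z₁ ∪ Z₂ ∧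
      Z ∩ A ⊆ Z₁ ∧ Z ∩ B ⊆ Z₂) ∨
    ∃ K ⊆ Z, IsCompact K ∧ IsConnected K ∧ (K ∩ A).Nonempty ∧ (K ∩ B).Nonempty := by
  have : CompactSpace Z := isCompact_iff_compactSpace.1 hZ
  by_cases h : ∀ a ∈ ((↑) ⁻¹' A : Set Z), ∀ b ∈ ((↑) ⁻¹' B : Set Z), b ∉ connectedComponent a
  · left
    obtain ⟨V, hV, hAV, hVB⟩ := exists_isClopen_of_notMem_connectedComponent
      (hA.preimage continuous_subtype_val) (hB.preimage continuous_subtype_val) h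
    refine ⟨(↑) '' V, (↑) '' Vᶜ, hV.isClosed.isCompact.image continuous_subtype_val,
      hV.compl.isClosed.isCompact.image continuous_subtype_val,
      (disjoint_image_iff Subtype.val_injective).2 disjoint_compl_right, ?_, ?_, ?_⟩
    · rw [← image_union, union_compl_self, image_univ, Subtype.range_coe]
    · rintro z ⟨hz, hzA⟩
      exact ⟨⟨z, hz⟩, hAV hzA, rfl⟩
    · rintro z ⟨hz, hzB⟩
      exact ⟨⟨z, hz⟩, fun hzV => Set.disjoint_left.1 hVB hzV hzB, rfl⟩
  · right
    push Not at h
    obtain ⟨a, ha, b, hb, hab⟩ := h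
    refine ⟨(↑) '' connectedComponent a, Subtype.coe_image_subset _ _,
      isClosed_connectedComponent.isCompact.image continuous_subtype_val,
      isConnected_connectedComponent.image _ continuous_subtype_val.continuousOn,
      ⟨a, ⟨a, mem_connectedComponent, rfl⟩, ha⟩, ⟨b, ⟨b, hab, rfl⟩, hb⟩⟩

/-- A continuum crossing from `P` to `Q` through `Z` contains a subcontinuum of `Z` meeting both
`P` and `Q`. -/
lemma IsConnected.exists_crossing [T2Space α] {K P Q Z : Set α} (hK : IsConnected K)
    (hKc : IsCompact K) (hP : IsClosed P) (hQ : IsClosed Q) (hZ : IsClosed Z)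
    (hPQ : Disjoint P Q) (hcov : K ⊆ P ∪ Z ∪ Q) (hKP : (K ∩ P).Nonempty)
    (hKQ : (K ∩ Q).Nonempty) :
    ∃ M ⊆ K ∩ Z, IsCompact M ∧ IsConnected M ∧ (M ∩ P).Nonempty ∧ (M ∩ Q).Nonempty := by
  rcases (hKc.inter_right hZ).exists_separation_or_continuum hP hQ with
    ⟨Z₁, Z₂, hZ₁, hZ₂, hdisj, heq, hA, hB⟩ | h
  · exfalso
    have hsub : ∀ z ∈ K, z ∈ Z → z ∈ Z₁ ∨ z ∈ Z₂ := fun z hz hzZ => by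
      have : z ∈ K ∩ Z := ⟨hz, hzZ⟩
      rwa [heq] at this
    have h1 : Z₁ ⊆ K ∩ Z := heq ▸ subset_union_left
    have h2 : Z₂ ⊆ K ∩ Z := heq ▸ subset_union_right
    obtain ⟨x, hxK, hx⟩ := isPreconnected_closed_iff.1 hK.isPreconnected
      ((K ∩ P) ∪ Z₁) ((K ∩ Q) ∪ Z₂)
      ((hKc.inter_right hP).isClosed.union hZ₁.isClosed)
      ((hKc.inter_right hQ).isClosed.union hZ₂.isClosed)
      (by
        intro z hz
        rcases hcov hz with (h | h) | h
        · exact Or.inl (Or.inl ⟨hz, h⟩)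
        · rcases hsub z hz h with h | h
          · exact Or.inl (Or.inr h)
          · exact Or.inr (Or.inr h)
        · exact Or.inr (Or.inl ⟨hz, h⟩))
      (hKP.mono fun z hz => ⟨hz.1, Or.inl hz⟩) (hKQ.mono fun z hz => ⟨hz.1, Or.inl hz⟩)
    have hd := Set.disjoint_left.1 hdisj
    rcases hx with ⟨hx1 | hx1, hx2 | hx2⟩
    · exact Set.disjoint_left.1 hPQ hx1.2 hx2.2
    · exact hd (hA ⟨h2 hx2, hx1.2⟩) hx2
    · exact hd hx1 (hB ⟨h1 hx1, hx2.2⟩)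
    · exact hd hx1 hx2
  · exact h

lemma IsClopenIn.inter {Y A B : Set α} (hA : IsClopenIn Y A) (hB : IsClopenIn Y B) :
    IsClopenIn Y (A ∩ B) := by
  obtain ⟨hAY, ⟨U, hU, hAU⟩, ⟨C, hC, hAC⟩⟩ := hA
  obtain ⟨-, ⟨U', hU', hBU⟩, ⟨C', hC', hBC⟩⟩ := hB
  refine ⟨inter_subset_left.trans hAY, ⟨U ∩ U', hU.inter hU', ?_⟩, ⟨C ∩ C', hC.inter hC', ?_⟩⟩
  · rw [hAU, hBU, ← inter_inter_distrib_left]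
  · rw [hAC, hBC, ← inter_inter_distrib_left]

lemma isClopenIn_self (Y : Set α) : IsClopenIn Y Y :=
  ⟨le_rfl, ⟨univ, isOpen_univ, (inter_univ Y).symm⟩, ⟨univ, isClosed_univ, (inter_univ Y).symm⟩⟩

/-- If every clopen subset of `Y` containing `w` leaves an open ball, then `w` can be joined to the
sphere by a continuum lying in the closure of each clopen subset of `Y ∩ closedBall c R`
containing `w`. -/
lemma exists_continuum_subset_closure_isClopenIn {α : Type*} [MetricSpace α] [ProperSpace α]
    {Y : Set α} {c w : α} {R : ℝ} (hwY : w ∈ Y) (hw : dist w c < R)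
    (h : ∀ V, IsClopenIn Y V → w ∈ V → ¬ V ⊆ Metric.ball c R) :
    ∃ K : Set α, IsCompact K ∧ IsConnected K ∧ w ∈ K ∧ (K ∩ Metric.sphere c R).Nonempty ∧
      ∀ V, IsClopenIn (Y ∩ Metric.closedBall c R) V → w ∈ V → K ⊆ closure V := by
  set D := Metric.closedBall c R with hD
  have hDc : IsCompact D := isCompact_closedBall c R
  set 𝒱 : Set (Set α) := {V | IsClopenIn (Y ∩ D) V ∧ w ∈ V} with h𝒱
  have hself : Y ∩ D ∈ 𝒱 := ⟨isClopenIn_self _, hwY, hw.le⟩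
  have hne : Nonempty 𝒱 := ⟨⟨_, hself⟩⟩
  set Z : Set α := ⋂ V : 𝒱, closure (V : Set α) with hZ
  have hZD : Z ⊆ D := (iInter_subset _ (⟨_, hself⟩ : 𝒱)).trans
    (closure_minimal inter_subset_right hDc.isClosed)
  have hZc : IsCompact Z := hDc.of_isClosed_subset (isClosed_iInter fun _ => isClosed_closure) hZD
  have hwZ : w ∈ Z := mem_iInter.2 fun V => subset_closure V.2.2
  rcases hZc.exists_separation_or_continuum (isClosed_singleton (x := w))
    (Metric.isClosed_sphere (x := c) (ε := R)) with
    ⟨Z₁, Z₂, hZ₁, hZ₂, hdisj, heq, hA, hB⟩ | ⟨K, hKZ, hKc, hK, hKw, hKs⟩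
  · exfalso
    obtain ⟨G, G', hG, hG', hZG, hZG', hGG'⟩ := SeparatedNhds.of_isCompact_isCompact hZ₁ hZ₂ hdisj
    have hZ₁ball : Z₁ ⊆ Metric.ball c R := by
      intro z hz
      have hzZ : z ∈ Z := heq ▸ Or.inl hz
      refine Metric.mem_ball.2 (lt_of_le_of_ne (Metric.mem_closedBall.1 (hZD hzZ)) fun hs => ?_)
      exact Set.disjoint_left.1 hdisj hz (hB ⟨hzZ, hs⟩)
    obtain ⟨V, hV⟩ := (hDc.diff ((hG.inter (Metric.isOpen_ball (x := c) (ε := R))).union hG')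
      ).elim_directed_family_closed (fun V : 𝒱 => closure (V : Set α))
      (fun _ => isClosed_closure)
      (by
        rw [eq_empty_iff_forall_notMem]
        rintro z ⟨hz, hzZ⟩
        apply hz.2
        have : z ∈ Z₁ ∪ Z₂ := heq ▸ hzZ
        rcases this with h | h
        · exact Or.inl ⟨hZG h, hZ₁ball h⟩
        · exact Or.inr (hZG' h))
      (fun V W => ⟨⟨V ∩ W, V.2.1.inter W.2.1, V.2.2, W.2.2⟩, closure_mono inter_subset_left,
        closure_mono inter_subset_right⟩)
    obtain ⟨V, ⟨hVD, ⟨U, hU, hVU⟩, ⟨C, hC, hVC⟩⟩, hwV⟩ := V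
    have hVsub : ∀ z ∈ V, z ∈ G ∩ Metric.ball c R ∨ z ∈ G' := by
      intro z hz
      by_contra hcon
      exact eq_empty_iff_forall_notMem.1 hV z ⟨⟨(hVD hz).2, hcon⟩, subset_closure hz⟩
    have hGG'' := Set.disjoint_left.1 hGG'
    refine h (V ∩ (G ∩ Metric.ball c R)) ⟨fun z hz => (hVD hz.1).1, ⟨U ∩ (G ∩ Metric.ball c R),
      hU.inter (hG.inter Metric.isOpen_ball), ?_⟩, ⟨C ∩ D ∩ G'ᶜ,
      (hC.inter hDc.isClosed).inter hG'.isClosed_compl, ?_⟩⟩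
      ⟨hwV, hZG (hA ⟨hwZ, rfl⟩), hw⟩ (fun z hz => hz.2.2)
    · ext z
      constructor
      · rintro ⟨hz, hz'⟩
        exact ⟨(hVD hz).1, (hVU ▸ hz : z ∈ Y ∩ D ∩ U).2, hz'⟩
      · rintro ⟨hzY, hzU, hz⟩
        exact ⟨hVU ▸ ⟨⟨hzY, Metric.ball_subset_closedBall hz.2⟩, hzU⟩, hz⟩
    · ext z
      constructor
      · rintro ⟨hz, hz'⟩
        exact ⟨(hVD hz).1, ⟨(hVC ▸ hz : z ∈ Y ∩ D ∩ C).2, (hVD hz).2⟩, hGG'' hz'.1⟩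
      · rintro ⟨hzY, ⟨hzC, hzD⟩, hz⟩
        have hzV : z ∈ V := hVC ▸ ⟨⟨hzY, hzD⟩, hzC⟩
        exact ⟨hzV, (hVsub z hzV).resolve_right hz⟩
  · obtain ⟨_, hwK, rfl⟩ := hKw
    exact ⟨K, hKc, hK, hwK, hKs, fun V hV hwV => hKZ.trans (iInter_subset _ (⟨V, hV, hwV⟩ : 𝒱))⟩

/-- In an uncountable family of nondegenerate subcontinua of a Suslinian space, some member meets
uncountably many others. -/
lemma IsSuslinian.exists_not_countable_inter {ι : Type*} {X : Set α} (hX : IsSuslinian X)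
    {T : Set ι} (hT : ¬ T.Countable) {F : ι → Set α}
    (hF : ∀ i ∈ T, F i ⊆ X ∧ IsCompact (F i) ∧ IsConnected (F i) ∧ (F i).Nontrivial) :
    ∃ i ∈ T, ¬ {j ∈ T | j ≠ i ∧ (F i ∩ F j).Nonempty}.Countable := by
  by_contra! hcon
  obtain ⟨M, hM⟩ := zorn_subset {M : Set ι | M ⊆ T ∧ M.PairwiseDisjoint F} (by
    intro c hc hchain
    exact ⟨⋃₀ c, ⟨sUnion_subset fun s hs => (hc hs).1,
      (pairwiseDisjoint_sUnion hchain.directedOn).2 fun s hs => (hc hs).2⟩,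
      fun s hs => subset_sUnion_of_mem hs⟩)
  obtain ⟨hMT, hMF⟩ := hM.prop
  have hMcount : M.Countable := by
    refine countable_of_injective_of_countable_image (f := F) ?_ (hX (F '' M) ?_ ?_)
    · intro i hi j hj hij
      by_contra hne
      have := hMF hi hj hne
      simp only [Function.onFun, hij, disjoint_self, bot_eq_empty] at this
      exact (hF j (hMT hj)).2.2.2.nonempty.ne_empty this
    · rintro _ ⟨i, hi, rfl⟩
      exact hF i (hMT hi)
    · rintro _ ⟨i, hi, rfl⟩ _ ⟨j, hj, rfl⟩ hij
      exact hMF hi hj fun h => hij (h ▸ rfl)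
  refine hT ((hMcount.union (hMcount.biUnion fun i hi => hcon i (hMT hi))).mono fun j hj => ?_)
  by_cases hjM : j ∈ M
  · exact Or.inl hjM
  · by_contra hj'
    refine hjM (hM.le_of_ge (y := insert j M) ⟨insert_subset hj hMT, ?_⟩ (subset_insert j M)
      (mem_insert j M))
    refine hMF.insert fun i hi hji => ?_
    by_contra hd
    refine hj' (Or.inr (mem_iUnion₂.2 ⟨i, hi, hj, hji, ?_⟩))
    rw [inter_comm]
    exact not_disjoint_iff_nonempty_inter.1 hd

end Continua

section Separation

lemma IsClopenIn.exists_disjoint_isOpen {α : Type*} [TopologicalSpace α] [CompletelyNormalSpace α]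
    {Y V : Set α} (h : IsClopenIn Y V) :
    ∃ A B : Set α, IsOpen A ∧ IsOpen B ∧ Disjoint A B ∧ V ⊆ A ∧ Y \ V ⊆ B := by
  obtain ⟨-, ⟨U, hU, hVU⟩, ⟨C, hC, hVC⟩⟩ := h
  have h1 : closure V ⊆ C := closure_minimal (hVC ▸ inter_subset_right) hC
  have h2 : closure (Y \ V) ⊆ Uᶜ := by
    refine closure_minimal (fun z hz hzU => hz.2 ?_) hU.isClosed_compl
    rw [hVU]
    exact ⟨hz.1, hzU⟩
  have h3 : SeparatedNhds V (Y \ V) := by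
    refine separatedNhds_iff_disjoint.2 (completely_normal ?_ ?_)
    · refine Set.disjoint_left.2 fun z hz hz' => hz'.2 ?_
      rw [hVC]
      exact ⟨hz'.1, h1 hz⟩
    · refine Set.disjoint_left.2 fun z hz hz' => h2 hz' ?_
      rw [hVU] at hz
      exact hz.2
  obtain ⟨A, B, hA, hB, hVA, hYB, hAB⟩ := h3
  exact ⟨A, B, hA, hB, hAB, hVA, hYB⟩

/-- Finitely many points of a subspace in which points are separated by clopen sets have disjoint
open neighborhoods whose traces on the subspace are clopen. -/
lemma exists_isOpen_separating {α ι : Type*} [TopologicalSpace α] [CompletelyNormalSpace α]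
    [Finite ι] [LinearOrder ι] {Y : Set α} {w : ι → α} (hw : Function.Injective w)
    (hwY : ∀ i, w i ∈ Y)
    (hsep : ∀ x ∈ Y, ∀ y ∈ Y, x ≠ y → ∃ V, IsClopenIn Y V ∧ x ∈ V ∧ y ∉ V) :
    ∃ W H : ι → Set α, (∀ i, IsOpen (W i)) ∧ (∀ i, IsOpen (H i)) ∧ (∀ i, w i ∈ W i) ∧
      (∀ i j, i ≠ j → Disjoint (W i) (W j)) ∧ (∀ i, Disjoint (W i) (H i)) ∧
      ∀ i, Y ⊆ W i ∪ H i := by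
  have h1 : ∀ i j, ∃ A B : Set α, i ≠ j →
      (IsOpen A ∧ IsOpen B ∧ Disjoint A B ∧ Y ⊆ A ∪ B ∧ w i ∈ A ∧ w j ∈ B) := by
    intro i j
    by_cases hij : i = j
    · exact ⟨∅, ∅, fun h => (h hij).elim⟩
    obtain ⟨V, hV, hi, hj⟩ := hsep _ (hwY i) _ (hwY j) (hw.ne hij)
    obtain ⟨A, B, hA, hB, hAB, hVA, hYB⟩ := hV.exists_disjoint_isOpen
    refine ⟨A, B, fun _ => ⟨hA, hB, hAB, fun y hy => ?_, hVA hi, hYB ⟨hwY j, hj⟩⟩⟩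
    by_cases hyV : y ∈ V
    · exact Or.inl (hVA hyV)
    · exact Or.inr (hYB ⟨hy, hyV⟩)
  choose A B hAB using h1
  set S : ι → ι → Set α := fun i j => if i < j then A i j else B j i with hS
  have hSopen : ∀ i j, i ≠ j → IsOpen (S i j) := by
    intro i j hij
    rcases lt_or_gt_of_ne hij with h | h
    · simpa [hS, h] using (hAB i j hij).1
    · simpa [hS, h.not_gt] using (hAB j i hij.symm).2.1
  have hSdisj : ∀ i j, i ≠ j → Disjoint (S i j) (S j i) := by
    intro i j hij
    rcases lt_or_gt_of_ne hij with h | h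
    · simpa [hS, h, h.not_gt] using (hAB i j hij).2.2.1
    · simpa [hS, h, h.not_gt] using (hAB j i hij.symm).2.2.1.symm
  have hScov : ∀ i j, i ≠ j → Y ⊆ S i j ∪ S j i := by
    intro i j hij
    rcases lt_or_gt_of_ne hij with h | h
    · simpa [hS, h, h.not_gt] using (hAB i j hij).2.2.2.1
    · simpa [hS, h, h.not_gt, union_comm] using (hAB j i hij.symm).2.2.2.1
  have hSmem : ∀ i j, i ≠ j → w i ∈ S i j := by
    intro i j hij
    rcases lt_or_gt_of_ne hij with h | h
    · simpa [hS, h] using (hAB i j hij).2.2.2.2.1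
    · simpa [hS, h.not_gt] using (hAB j i hij.symm).2.2.2.2.2
  refine ⟨fun i => ⋂ j, ⋂ _ : i ≠ j, S i j, fun i => ⋃ j, ⋃ _ : i ≠ j, S j i, ?_, ?_, ?_, ?_, ?_,
    ?_⟩
  · exact fun i => isOpen_iInter_of_finite fun j => isOpen_iInter_of_finite fun h => hSopen i j h
  · exact fun i => isOpen_iUnion fun j => isOpen_iUnion fun h => hSopen j i h.symm
  · exact fun i => mem_iInter₂.2 fun j h => hSmem i j h
  · exact fun i j hij => (hSdisj i j hij).mono (iInter₂_subset j hij) (iInter₂_subset i hij.symm)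
  · intro i
    refine Set.disjoint_left.2 fun z hz hz' => ?_
    obtain ⟨j, hij, hzj⟩ := mem_iUnion₂.1 hz'
    exact Set.disjoint_left.1 (hSdisj i j hij) (mem_iInter₂.1 hz j hij) hzj
  · intro i y hy
    by_cases h : y ∈ ⋃ j, ⋃ _ : i ≠ j, S j i
    · exact Or.inr h
    · refine Or.inl (mem_iInter₂.2 fun j hij => (hScov i j hij hy).resolve_right fun h' => ?_)
      exact h (mem_iUnion₂.2 ⟨j, hij, h'⟩)

end Separation

section PathComponents

variable {E : Type*} [NormedAddCommGroup E] [NormedSpace ℝ E] {D U : Set E} {x y : E}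

lemma Convex.exists_ball_joinedIn (hD : Convex ℝ D) (hU : IsOpen U) (hy : y ∈ D ∩ U) :
    ∃ δ > 0, ∀ z ∈ Metric.ball y δ ∩ D, JoinedIn (D ∩ U) y z := by
  obtain ⟨δ, hδ, hδU⟩ := Metric.isOpen_iff.1 hU y hy.2
  refine ⟨δ, hδ, fun z hz => ?_⟩
  have hconv : Convex ℝ (Metric.ball y δ ∩ D) := (convex_ball y δ).inter hD
  have hy' : y ∈ Metric.ball y δ ∩ D := ⟨Metric.mem_ball_self hδ, hy.1⟩
  exact ((hconv.isPathConnected ⟨y, hy'⟩).joinedIn y hy' z hz).mono fun v hv => ⟨hv.2, hδU hv.1⟩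

lemma Convex.mem_pathComponentIn_of_mem_closure (hD : Convex ℝ D) (hU : IsOpen U)
    (hy : y ∈ D ∩ U) (hyc : y ∈ closure (pathComponentIn (D ∩ U) x)) :
    y ∈ pathComponentIn (D ∩ U) x := by
  obtain ⟨δ, hδ, h⟩ := hD.exists_ball_joinedIn hU hy
  obtain ⟨z, hz, hyz⟩ := Metric.mem_closure_iff.1 hyc δ hδ
  rw [dist_comm] at hyz
  exact JoinedIn.trans hz (h z ⟨hyz, (pathComponentIn_subset hz).1⟩).symm

lemma Convex.exists_ball_subset_pathComponentIn (hD : Convex ℝ D) (hU : IsOpen U)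
    (hy : y ∈ pathComponentIn (D ∩ U) x) :
    ∃ δ > 0, Metric.ball y δ ∩ D ⊆ pathComponentIn (D ∩ U) x := by
  obtain ⟨δ, hδ, h⟩ := hD.exists_ball_joinedIn hU (pathComponentIn_subset hy)
  exact ⟨δ, hδ, fun z hz => JoinedIn.trans hy (h z hz)⟩

end PathComponents

section FourPoints

/-- There are no four pairwise disjoint, relatively open, path connected subsets of a closed disc
which all reach the bounding circle, have pairwise touching closures, and are attached to pairwise
intersecting continua in the interior of the disc. -/
lemma false_of_four_touching_sets {c : Plane} {R : ℝ} (hR : 0 < R) {O J : Fin 4 → Set Plane}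
    {w : Fin 4 → Plane} (hO : ∀ i, IsPathConnected (O i)) (hOD : ∀ i, O i ⊆ Metric.closedBall c R)
    (hOopen : ∀ i, ∀ y ∈ O i, ∃ δ > 0, Metric.ball y δ ∩ Metric.closedBall c R ⊆ O i)
    (hOO : ∀ i j, i ≠ j → Disjoint (O i) (O j))
    (hOs : ∀ i, (O i ∩ Metric.sphere c R).Nonempty)
    (hwO : ∀ i, w i ∈ O i) (hwJ : ∀ i, w i ∈ J i) (hJc : ∀ i, IsCompact (J i))
    (hJ : ∀ i, IsConnected (J i)) (hJR : ∀ i, J i ⊆ Metric.ball c R)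
    (hJJ : ∀ i j, i ≠ j → (J i ∩ J j).Nonempty) (hJO : ∀ i j, i ≠ j → Disjoint (J i) (O j))
    (htouch : ∀ i j, i ≠ j → ∃ x ∈ closure (O i) ∩ closure (O j), ∀ k, x ∉ J k) : False := by
  choose θ hθO hθs using hOs
  have hθ : Function.Injective θ := by
    intro i j hij
    by_contra hne
    exact Set.disjoint_left.1 (hOO i j hne) (hθO i) (hij ▸ hθO j)
  obtain ⟨σ, hσ⟩ := exists_perm_not_disjoint_of_joinedIn hR hθ hθs
  have hne : ∀ i j, i ≠ j → σ i ≠ σ j := fun i j hij => σ.injective.ne hij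
  have main : ∀ a b p q : Fin 4, a ≠ b → a ≠ p → a ≠ q → b ≠ p → b ≠ q → p ≠ q →
      ∃ F G : Set Plane, F ⊆ Metric.closedBall c R ∧ G ⊆ Metric.closedBall c R ∧ Disjoint F G ∧
        JoinedIn F (θ a) (θ p) ∧ JoinedIn G (θ b) (θ q) := by
    intro a b p q hab hap haq hbp hbq hpq
    obtain ⟨γa, hγa⟩ := (hO a).joinedIn _ (hθO a) _ (hwO a)
    obtain ⟨γp, hγp⟩ := (hO p).joinedIn _ (hθO p) _ (hwO p)
    have hra : range γa ⊆ O a := range_subset_iff.2 hγa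
    have hrp : range γp ⊆ O p := range_subset_iff.2 hγp
    set Γ : Set Plane := range γa ∪ (J a ∪ J p) ∪ range γp with hΓ
    have hΓc : IsCompact Γ := ((isCompact_range γa.continuous).union ((hJc a).union (hJc p))).union
      (isCompact_range γp.continuous)
    obtain ⟨x, ⟨hxb, hxq⟩, hxJ⟩ := htouch b q hbq
    have hxD : x ∈ Metric.closedBall c R := closure_minimal (hOD b) Metric.isClosed_closedBall hxb
    have hxO : ∀ k, b ≠ k → x ∉ O k := by
      intro k hbk hx
      obtain ⟨δ, hδ, hsub⟩ := hOopen k x hx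
      obtain ⟨y, hy, hxy⟩ := Metric.mem_closure_iff.1 hxb δ hδ
      rw [dist_comm] at hxy
      exact Set.disjoint_left.1 (hOO b k hbk) hy (hsub ⟨hxy, hOD b hy⟩)
    have hxΓ : x ∈ Γᶜ := by
      rintro ((h | h | h) | h)
      · exact hxO a hab.symm (hra h)
      · exact hxJ a h
      · exact hxJ p h
      · exact hxO p hbp (hrp h)
    obtain ⟨δ, hδ, hδΓ⟩ := Metric.isOpen_iff.1 hΓc.isClosed.isOpen_compl x hxΓ
    obtain ⟨y, hy, hxy⟩ := Metric.mem_closure_iff.1 hxb δ hδ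
    obtain ⟨z, hz, hxz⟩ := Metric.mem_closure_iff.1 hxq δ hδ
    rw [dist_comm] at hxy hxz
    have hconv : Convex ℝ (Metric.ball x δ ∩ Metric.closedBall c R) :=
      (convex_ball x δ).inter (convex_closedBall c R)
    set G₀ : Set Plane := O b ∪ (Metric.ball x δ ∩ Metric.closedBall c R) ∪ O q with hG₀
    have hbr : JoinedIn G₀ (θ b) (θ q) := by
      refine ((((hO b).joinedIn _ (hθO b) _ hy).mono ?_).trans
        (((hconv.isPathConnected ⟨y, hxy, hOD b hy⟩).joinedIn y ⟨hxy, hOD b hy⟩ z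
          ⟨hxz, hOD q hz⟩).mono ?_)).trans (((hO q).joinedIn _ hz _ (hθO q)).mono ?_)
      · exact fun v hv => Or.inl (Or.inl hv)
      · exact fun v hv => Or.inl (Or.inr hv)
      · exact fun v hv => Or.inr hv
    obtain ⟨g, hg⟩ := hbr
    have hgΓ : ∀ v ∈ range g, v ∉ Γ := by
      have hO' : ∀ k, a ≠ k → p ≠ k → ∀ v ∈ O k, v ∉ Γ := by
        rintro k hak hpk v hv ((h | h | h) | h)
        · exact Set.disjoint_left.1 (hOO a k hak) (hra h) hv
        · exact Set.disjoint_left.1 (hJO a k hak) h hv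
        · exact Set.disjoint_left.1 (hJO p k hpk) h hv
        · exact Set.disjoint_left.1 (hOO p k hpk) (hrp h) hv
      rintro _ ⟨t, rfl⟩
      rcases hg t with (h | h) | h
      · exact hO' b hab hbp.symm _ h
      · exact hδΓ h.1
      · exact hO' q haq hpq _ h
    set U : Set Plane := (range g)ᶜ ∩ Metric.ball c R with hU
    have hUo : IsOpen U :=
      (isCompact_range g.continuous).isClosed.isOpen_compl.inter Metric.isOpen_ball
    have hJU : J a ∪ J p ⊆ U := by
      intro v hv
      refine ⟨fun hvg => hgΓ v hvg (Or.inl (Or.inr hv)), ?_⟩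
      rcases hv with hv | hv
      · exact hJR a hv
      · exact hJR p hv
    have hJconn : IsPreconnected (J a ∪ J p) :=
      ((hJ a).union (hJJ a p hap) (hJ p)).isPreconnected
    have haU : w a ∈ U := hJU (Or.inl (hwJ a))
    have hJN := hJconn.subset_connectedComponentIn (Or.inl (hwJ a)) hJU
    have hNpc : IsPathConnected (connectedComponentIn U (w a)) :=
      hUo.connectedComponentIn.isConnected_iff_isPathConnected.1
        (isConnected_connectedComponentIn_iff.2 haU)
    have hNU := connectedComponentIn_subset U (w a)
    set N := connectedComponentIn U (w a)
    refine ⟨range γa ∪ N ∪ range γp, range g, ?_, ?_, ?_, ?_, ⟨g, mem_range_self⟩⟩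
    · rintro v ((h | h) | h)
      · exact hOD a (hra h)
      · exact Metric.ball_subset_closedBall (hNU h).2
      · exact hOD p (hrp h)
    · rintro _ ⟨t, rfl⟩
      rcases hg t with (h | h) | h
      · exact hOD b h
      · exact h.2
      · exact hOD q h
    · refine Set.disjoint_left.2 ?_
      rintro v ((h | h) | h) hvg
      · exact hgΓ v hvg (Or.inl (Or.inl h))
      · exact (hNU h).1 hvg
      · exact hgΓ v hvg (Or.inr h)
    · have h1 : JoinedIn (range γa) (θ a) (w a) := ⟨γa, mem_range_self⟩
      have h2 : JoinedIn (range γp) (θ p) (w p) := ⟨γp, mem_range_self⟩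
      have h3 : JoinedIn N (w a) (w p) :=
        hNpc.joinedIn _ (hJN (Or.inl (hwJ a))) _ (hJN (Or.inr (hwJ p)))
      refine ((h1.mono ?_).trans (h3.mono ?_)).trans (h2.symm.mono ?_)
      · exact fun v hv => Or.inl (Or.inl hv)
      · exact fun v hv => Or.inl (Or.inr hv)
      · exact fun v hv => Or.inr hv
  obtain ⟨F, G, hF, hG, hFG, hFj, hGj⟩ := main (σ 0) (σ 1) (σ 2) (σ 3) (hne _ _ (by decide))
    (hne _ _ (by decide)) (hne _ _ (by decide)) (hne _ _ (by decide)) (hne _ _ (by decide))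
    (hne _ _ (by decide))
  exact hσ F G hF hG hFj hGj hFG

/-- Four points of a subspace `Y` of the plane, all of whose clopen neighborhoods leave a disc,
cannot be attached to two families of pairwise intersecting continua: one meeting `Y` only in the
given points, the other one away from the first and in the closure of every clopen neighborhood. -/
lemma false_of_four_points {Y : Set Plane} {c : Plane} {R : ℝ} (hR : 0 < R) {w : Fin 4 → Plane}
    (hw : Function.Injective w) (hwY : ∀ i, w i ∈ Y)
    (hbad : ∀ i V, IsClopenIn Y V → w i ∈ V → ¬ V ⊆ Metric.ball c R)
    (hsep : ∀ x ∈ Y, ∀ y ∈ Y, x ≠ y → ∃ V, IsClopenIn Y V ∧ x ∈ V ∧ y ∉ V)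
    {J M : Fin 4 → Set Plane} (hwJ : ∀ i, w i ∈ J i) (hJY : ∀ i, ∀ y ∈ J i, y ∈ Y → y = w i)
    (hJc : ∀ i, IsCompact (J i)) (hJ : ∀ i, IsConnected (J i))
    (hJR : ∀ i, J i ⊆ Metric.ball c R) (hJJ : ∀ i j, i ≠ j → (J i ∩ J j).Nonempty)
    (hM : ∀ i V, IsClopenIn (Y ∩ Metric.closedBall c R) V → w i ∈ V → M i ⊆ closure V)
    (hMM : ∀ i j, i ≠ j → (M i ∩ M j).Nonempty) (hMJ : ∀ i j, Disjoint (M i) (J j)) : False := by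
  set D := Metric.closedBall c R with hD
  have hDconv : Convex ℝ D := convex_closedBall c R
  have hDclosed : IsClosed D := Metric.isClosed_closedBall
  have hwD : ∀ i, w i ∈ D := fun i => Metric.ball_subset_closedBall (hJR i (hwJ i))
  obtain ⟨W, H, hW, hH, hwW, hWW, hWH, hcov⟩ := exists_isOpen_separating (Y := Y ∩ D) hw
    (fun i => ⟨hwY i, hwD i⟩) (by
      intro x hx y hy hxy
      obtain ⟨V, ⟨-, ⟨U, hU, hVU⟩, ⟨C, hC, hVC⟩⟩, hxV, hyV⟩ := hsep x hx.1 y hy.1 hxy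
      refine ⟨V ∩ D, ⟨fun z hz => ⟨?_, hz.2⟩, ⟨U, hU, ?_⟩, ⟨C, hC, ?_⟩⟩, ⟨hxV, hx.2⟩,
        fun h => hyV h.1⟩
      · exact (hVU ▸ hz.1 : z ∈ Y ∩ U).1
      · rw [hVU, inter_right_comm]
      · rw [hVC, inter_right_comm])
  set U : Fin 4 → Set Plane := fun i => W i ∩ ⋂ j, ⋂ _ : i ≠ j, (J j)ᶜ with hU
  have hUo : ∀ i, IsOpen (U i) := fun i => (hW i).inter
    (isOpen_iInter_of_finite fun j => isOpen_iInter_of_finite fun _ =>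
      (hJc j).isClosed.isOpen_compl)
  set O : Fin 4 → Set Plane := fun i => pathComponentIn (D ∩ U i) (w i) with hO
  have hwU : ∀ i, w i ∈ D ∩ U i := by
    refine fun i => ⟨hwD i, hwW i, mem_iInter₂.2 fun j hij hj => ?_⟩
    exact hij (hw (hJY j _ hj (hwY i)))
  have hwO : ∀ i, w i ∈ O i := fun i => mem_pathComponentIn_self (hwU i)
  have hOsub : ∀ i, O i ⊆ D ∩ U i := fun i => pathComponentIn_subset
  have hOW : ∀ i, O i ⊆ W i := fun i z hz => (hOsub i hz).2.1
  have hOJ : ∀ i j, i ≠ j → ∀ z ∈ O i, z ∉ J j := fun i j hij z hz =>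
    mem_iInter₂.1 (hOsub i hz).2.2 j hij
  have hOopen : ∀ i, ∀ y ∈ O i, ∃ δ > 0, Metric.ball y δ ∩ D ⊆ O i :=
    fun i y hy => hDconv.exists_ball_subset_pathComponentIn (hUo i) hy
  have hnotcl : ∀ i (S : Set Plane), IsOpen S → Disjoint (W i) S → ∀ z ∈ closure (O i), z ∉ S := by
    intro i S hS hWS z hz hzS
    obtain ⟨v, hvS, hvO⟩ := mem_closure_iff.1 hz S hS hzS
    exact Set.disjoint_left.1 hWS (hOW i hvO) hvS
  have hcl : ∀ i, ∀ z ∈ Y ∩ D, z ∈ closure (O i) → z ∈ O i := by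
    intro i z hz hzc
    refine hDconv.mem_pathComponentIn_of_mem_closure (hUo i) ⟨hz.2, ?_, ?_⟩ hzc
    · exact (hcov i hz).resolve_right (hnotcl i _ (hH i) (hWH i) z hzc)
    · refine mem_iInter₂.2 fun j hij hj => ?_
      have := hJY j z hj hz.1
      subst this
      exact hnotcl i _ (hW j) (hWW i j hij) _ hzc (hwW j)
  have hint : ∀ i, ∀ z ∈ O i, z ∈ interior (O i ∪ Dᶜ) := by
    intro i z hz
    obtain ⟨δ, hδ, hsub⟩ := hOopen i z hz
    refine mem_interior_iff_mem_nhds.2 (Filter.mem_of_superset (Metric.ball_mem_nhds z hδ) ?_)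
    intro v hv
    by_cases hvD : v ∈ D
    · exact Or.inl (hsub ⟨hv, hvD⟩)
    · exact Or.inr hvD
  have hint' : ∀ i, ∀ z ∈ interior (O i ∪ Dᶜ), z ∈ D → z ∈ O i :=
    fun i z hz hzD => (interior_subset hz).resolve_right (not_not_intro hzD)
  have hclopen : ∀ i, IsClopenIn (Y ∩ D) ((Y ∩ D) ∩ O i) := by
    refine fun i => ⟨inter_subset_left, ⟨_, isOpen_interior (s := O i ∪ Dᶜ), ?_⟩,
      ⟨_, isClosed_closure (s := O i), ?_⟩⟩
    · ext z
      exact ⟨fun hz => ⟨hz.1, hint i z hz.2⟩, fun hz => ⟨hz.1, hint' i z hz.2 hz.1.2⟩⟩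
    · ext z
      exact ⟨fun hz => ⟨hz.1, subset_closure hz.2⟩, fun hz => ⟨hz.1, hcl i z hz.1 hz.2⟩⟩
  have hMO : ∀ i, M i ⊆ closure (O i) := fun i =>
    (hM i _ (hclopen i) ⟨⟨hwY i, hwD i⟩, hwO i⟩).trans (closure_mono inter_subset_right)
  refine false_of_four_touching_sets hR (O := O) (J := J) (w := w)
    (fun i => isPathConnected_pathComponentIn (hwU i)) (fun i z hz => (hOsub i hz).1) hOopen
    (fun i j hij => (hWW i j hij).mono (hOW i) (hOW j)) ?_ hwO hwJ hJc hJ hJR hJJ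
    (fun i j hij => Set.disjoint_left.2 fun z hz hz' => hOJ j i hij.symm z hz' hz) ?_
  · intro i
    by_contra hempty
    have hOball : O i ⊆ Metric.ball c R := by
      intro z hz
      refine Metric.mem_ball.2 (lt_of_le_of_ne (Metric.mem_closedBall.1 (hOsub i hz).1) ?_)
      exact fun h => hempty ⟨z, hz, h⟩
    refine hbad i (Y ∩ O i) ⟨inter_subset_left, ⟨interior (O i ∪ Dᶜ) ∩ Metric.ball c R,
      isOpen_interior.inter Metric.isOpen_ball, ?_⟩, ⟨closure (O i) ∩ D,
      isClosed_closure.inter hDclosed, ?_⟩⟩ ⟨hwY i, hwO i⟩ (inter_subset_right.trans hOball)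
    · ext z
      exact ⟨fun hz => ⟨hz.1, hint i z hz.2, hOball hz.2⟩,
        fun hz => ⟨hz.1, hint' i z hz.2.1 (Metric.ball_subset_closedBall hz.2.2)⟩⟩
    · ext z
      exact ⟨fun hz => ⟨hz.1, subset_closure hz.2, (hOsub i hz.2).1⟩,
        fun hz => ⟨hz.1, hcl i z ⟨hz.1, hz.2.2⟩ hz.2.1⟩⟩
  · intro i j hij
    obtain ⟨x, hxi, hxj⟩ := hMM i j hij
    exact ⟨x, ⟨hMO i hxi, hMO j hxj⟩, fun k => Set.disjoint_left.1 (hMJ i k) hxi⟩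

end FourPoints

section SuslinianSubspaces

variable {α : Type*} [TopologicalSpace α] {Y : Set α}

lemma IsClopen.isClopenIn_image {V : Set Y} (hV : IsClopen V) : IsClopenIn Y ((↑) '' V) := by
  obtain ⟨C, hC, hCV⟩ := isClosed_induced_iff.1 hV.isClosed
  obtain ⟨U, hU, hUV⟩ := isOpen_induced_iff.1 hV.isOpen
  refine ⟨Subtype.coe_image_subset _ _, ⟨U, hU, ?_⟩, ⟨C, hC, ?_⟩⟩
  · rw [← hUV, Subtype.image_preimage_coe]
  · rw [← hCV, Subtype.image_preimage_coe]

lemma IsClopenIn.isClopen_preimage {V : Set α} (hV : IsClopenIn Y V) :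
    IsClopen ((↑) ⁻¹' V : Set Y) := by
  obtain ⟨-, ⟨U, hU, hVU⟩, ⟨C, hC, hVC⟩⟩ := hV
  constructor
  · rw [hVC, Subtype.preimage_coe_self_inter]
    exact hC.preimage continuous_subtype_val
  · rw [hVU, Subtype.preimage_coe_self_inter]
    exact hU.preimage continuous_subtype_val

lemma IsAlmostZeroDimensionalSpace.exists_isClopenIn [T1Space α]
    (hY : IsAlmostZeroDimensionalSpace Y) {x y : α} (hx : x ∈ Y) (hy : y ∈ Y) (hxy : x ≠ y) :
    ∃ V, IsClopenIn Y V ∧ x ∈ V ∧ y ∉ V := by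
  have hxy' : (⟨x, hx⟩ : Y) ∈ ({⟨y, hy⟩}ᶜ : Set Y) := fun h => hxy (congrArg Subtype.val h)
  obtain ⟨V, hV, hVy, 𝒞, h𝒞, rfl⟩ := hY ⟨x, hx⟩ _ isClosed_singleton.isOpen_compl hxy'
  have hy' : (⟨y, hy⟩ : Y) ∉ ⋂₀ 𝒞 := fun h => hVy h rfl
  obtain ⟨E, hE, hyE, hdisj⟩ := exists_isClopen_mem_disjoint_sInter h𝒞 hy'
  refine ⟨_, hE.compl.isClopenIn_image, ⟨⟨x, hx⟩, fun hxE => ?_, rfl⟩, ?_⟩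
  · exact Set.disjoint_left.1 hdisj hxE (mem_of_mem_nhds hV)
  · rintro ⟨z, hz, rfl⟩
    exact hz hyE

/-- In a subspace of a Suslinian compactum in the plane in which points are separated by clopen
sets, only countably many points of a disc have no clopen neighborhood inside the disc of five times
the radius. -/
lemma IsSuslinian.countable_setOf_not_subset_ball {X Y : Set Plane} (hX : IsSuslinian X)
    (hXc : IsClosed X) (hYX : Y ⊆ X)
    (hsep : ∀ x ∈ Y, ∀ y ∈ Y, x ≠ y → ∃ V, IsClopenIn Y V ∧ x ∈ V ∧ y ∉ V) (c : Plane) {r : ℝ}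
    (hr : 0 < r) :
    {w | w ∈ Y ∧ dist w c < r ∧
      ∀ V, IsClopenIn Y V → w ∈ V → ¬ V ⊆ Metric.ball c (5 * r)}.Countable := by
  by_contra hQ
  set Q := {w | w ∈ Y ∧ dist w c < r ∧
    ∀ V, IsClopenIn Y V → w ∈ V → ¬ V ⊆ Metric.ball c (5 * r)} with hQdef
  have hle : ∀ s, IsClosed {z : Plane | dist z c ≤ s} := fun s =>
    isClosed_le (by fun_prop) continuous_const
  have hge : ∀ s, IsClosed {z : Plane | s ≤ dist z c} := fun s =>
    isClosed_le continuous_const (by fun_prop)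
  have key : ∀ w ∈ Q, ∃ L C M : Set Plane,
      (IsCompact L ∧ IsConnected L ∧ w ∈ L ∧ (∀ z ∈ L, dist z c ≤ 2 * r) ∧
        ∀ y ∈ L, y ∈ Y → y = w) ∧
      (C ⊆ L ∧ (∀ z ∈ C, z ∉ Y) ∧ (C ⊆ X ∧ IsCompact C ∧ IsConnected C ∧ C.Nontrivial)) ∧
      (M ⊆ X ∧ IsCompact M ∧ IsConnected M ∧ M.Nontrivial) ∧ (∀ z ∈ M, 3 * r ≤ dist z c) ∧
      ∀ V, IsClopenIn (Y ∩ Metric.closedBall c (5 * r)) V → w ∈ V → M ⊆ closure V := by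
    rintro w ⟨hwY, hwr, hwV⟩
    obtain ⟨K, hKc, hK, hwK, ⟨s, hsK, hs⟩, hKV⟩ :=
      exists_continuum_subset_closure_isClopenIn hwY (by linarith) hwV
    have hs' : dist s c = 5 * r := hs
    have hwD : w ∈ Metric.closedBall c (5 * r) := Metric.mem_closedBall.2 (by linarith)
    have hKX : K ⊆ X := (hKV _ (isClopenIn_self _) ⟨hwY, hwD⟩).trans
      (closure_minimal (inter_subset_left.trans hYX) hXc)
    have hKY : ∀ y ∈ K, y ∈ Y → y = w := by
      intro y hyK hyY
      by_contra hne
      obtain ⟨V, ⟨-, ⟨U, hU, hVU⟩, ⟨A, hA, hVA⟩⟩, hwV', hyV⟩ := hsep w hwY y hyY (Ne.symm hne)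
      have hVD : IsClopenIn (Y ∩ Metric.closedBall c (5 * r))
          (V ∩ Metric.closedBall c (5 * r)) := by
        refine ⟨fun z hz => ⟨(hVU ▸ hz.1 : z ∈ Y ∩ U).1, hz.2⟩, ⟨U, hU, ?_⟩, ⟨A, hA, ?_⟩⟩
        · rw [hVU, inter_right_comm]
        · rw [hVA, inter_right_comm]
      have hyA : y ∈ A := closure_minimal
        (fun z hz => (hVA ▸ hz.1 : z ∈ Y ∩ A).2) hA (hKV _ hVD ⟨hwV', hwD⟩ hyK)
      exact hyV (hVA ▸ ⟨hyY, hyA⟩)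
    obtain ⟨L, hLK, hLc, hL, ⟨_, hwL, rfl⟩, ⟨t, htL, ht⟩⟩ := hK.exists_crossing hKc
      (isClosed_singleton (x := w)) (hge (2 * r)) (hle (2 * r))
      (by
        rw [Set.disjoint_singleton_left]
        exact fun h => by linarith [show 2 * r ≤ dist w c from h])
      (fun z _ => (le_total (dist z c) (2 * r)).elim (fun h => Or.inl (Or.inr h)) Or.inr)
      ⟨w, hwK, rfl⟩ ⟨s, hsK, by simp only [mem_ofPred_eq]; linarith⟩
    obtain ⟨C, hCL, hCc, hC, ⟨u, huC, hu⟩, ⟨v, hvC, hv⟩⟩ := hL.exists_crossing hLc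
      (hle r) (hge (2 * r)) (hge r)
      (Set.disjoint_left.2 fun z hz hz' => by
        simp only [mem_ofPred_eq] at hz hz'
        linarith)
      (fun z _ => (le_total (dist z c) r).elim (fun h => Or.inl (Or.inl h))
        fun h => Or.inl (Or.inr h))
      ⟨_, hwL, hwr.le⟩ ⟨t, htL, ht⟩
    obtain ⟨M, hMK, hMc, hM, ⟨u', huM, hu'⟩, ⟨v', hvM, hv'⟩⟩ := hK.exists_crossing hKc
      (hle (3 * r)) (hge (4 * r)) (hge (3 * r))
      (Set.disjoint_left.2 fun z hz hz' => by
        simp only [mem_ofPred_eq] at hz hz'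
        linarith)
      (fun z _ => (le_total (dist z c) (3 * r)).elim (fun h => Or.inl (Or.inl h))
        fun h => Or.inl (Or.inr h))
      ⟨_, hwK, by simp only [mem_ofPred_eq]; linarith⟩
      ⟨s, hsK, by simp only [mem_ofPred_eq]; linarith⟩
    simp only [mem_ofPred_eq] at hu hv hu' hv'
    refine ⟨L, C, M, ⟨hLc, hL, hwL, fun z hz => (hLK hz).2, fun y hy => hKY y (hLK hy).1⟩,
      ⟨fun z hz => (hCL hz).1, fun z hz hzY => ?_, fun z hz => hKX (hLK (hCL hz).1).1, hCc, hC,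
        ⟨u, huC, v, hvC, ?_⟩⟩,
      ⟨fun z hz => hKX (hMK hz).1, hMc, hM, ⟨u', huM, v', hvM, ?_⟩⟩, fun z hz => (hMK hz).2,
      fun V hV hwV => (fun z hz => hKV V hV hwV (hMK hz).1)⟩
    · have h1 : r ≤ dist z c := (hCL hz).2
      rw [hKY z (hLK (hCL hz).1).1 hzY] at h1
      linarith
    · rintro rfl
      linarith
    · rintro rfl
      linarith
  choose! L C M hL hC hMc hMdist hMV using key
  obtain ⟨w₀, hw₀, hQ₀⟩ := hX.exists_not_countable_inter hQ (F := C) fun w hw => (hC w hw).2.2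
  set Q₀ := {w ∈ Q | w ≠ w₀ ∧ (C w₀ ∩ C w).Nonempty} with hQ₀def
  obtain ⟨w₁, hw₁, hQ₁⟩ := hX.exists_not_countable_inter hQ₀ (F := M) fun w hw => hMc w hw.1
  obtain ⟨w₂, hw₂, hQ₂⟩ := hX.exists_not_countable_inter hQ₁ (F := M) fun w hw => hMc w hw.1.1
  obtain ⟨w₃, hw₃, hQ₃⟩ := hX.exists_not_countable_inter hQ₂ (F := M) fun w hw => hMc w hw.1.1.1
  obtain ⟨w₄, hw₄⟩ := Set.Infinite.nonempty fun h => hQ₃ h.countable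
  set w : Fin 4 → Plane := ![w₁, w₂, w₃, w₄] with hwdef
  have hlt : ∀ i j, i < j → w j ≠ w i ∧ (M (w i) ∩ M (w j)).Nonempty := by
    intro i j hij
    fin_cases i <;> fin_cases j <;> first | exact absurd hij (by decide) | skip
    · exact hw₂.2
    · exact hw₃.1.2
    · exact hw₄.1.1.2
    · exact hw₃.2
    · exact hw₄.1.2
    · exact hw₄.2
  have hmem : ∀ i, w i ∈ Q₀ := by
    intro i
    fin_cases i
    · exact hw₁
    · exact hw₂.1
    · exact hw₃.1.1
    · exact hw₄.1.1.1
  have hwinj : Function.Injective w := by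
    intro i j hij
    by_contra hne
    rcases lt_or_gt_of_ne hne with h | h
    · exact (hlt i j h).1 hij.symm
    · exact (hlt j i h).1 hij
  have hJR : ∀ i, ∀ z ∈ L (w i) ∪ C w₀, dist z c ≤ 2 * r := by
    rintro i z (hz | hz)
    · exact (hL _ (hmem i).1).2.2.2.1 z hz
    · exact (hL _ hw₀).2.2.2.1 z ((hC _ hw₀).1 hz)
  refine false_of_four_points (Y := Y) (c := c) (R := 5 * r) (by linarith) hwinj
    (fun i => (hmem i).1.1) (fun i => (hmem i).1.2.2) hsep (J := fun i => L (w i) ∪ C w₀)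
    (M := fun i => M (w i)) (fun i => Or.inl (hL _ (hmem i).1).2.2.1) ?_ ?_ ?_ ?_ ?_
    (fun i => hMV _ (hmem i).1) ?_ ?_
  · rintro i y (hy | hy) hyY
    · exact (hL _ (hmem i).1).2.2.2.2 y hy hyY
    · exact ((hC _ hw₀).2.1 y hy hyY).elim
  · exact fun i => (hL _ (hmem i).1).1.union (hC _ hw₀).2.2.2.1
  · intro i
    obtain ⟨z, hz₀, hz⟩ := (hmem i).2.2
    exact (hL _ (hmem i).1).2.1.union ⟨z, (hC _ (hmem i).1).1 hz, hz₀⟩ (hC _ hw₀).2.2.2.2.1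
  · exact fun i z hz => Metric.mem_ball.2 (by linarith [hJR i z hz])
  · intro i j _
    obtain ⟨z, hz⟩ := (hC _ hw₀).2.2.2.2.1.nonempty
    exact ⟨z, Or.inr hz, Or.inr hz⟩
  · intro i j hij
    rcases lt_or_gt_of_ne hij with h | h
    · exact (hlt i j h).2
    · rw [inter_comm]
      exact (hlt j i h).2
  · refine fun i j => Set.disjoint_left.2 fun z hz hz' => ?_
    have h1 := hMdist _ (hmem i).1 z hz
    have h2 := hJR j z hz'
    linarith

end SuslinianSubspaces

/-- Proposition: in a Suslinian plane continuum, almost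
zero-dimensional subspaces are zero-dimensional. -/
theorem stmt_16 (X : Set Plane) (hXcomp : IsCompact X) (hXconn : IsConnected X)
    (hXsus : IsSuslinian X) (Y : Set Plane) (hYX : Y ⊆ X)
    (hY : IsAlmostZeroDimensionalSpace ↥Y) :
    IsZeroDimensionalSpace ↥Y := by
  refine hY.isZeroDimensionalSpace_of_countable ?_
  have hcount : ∀ m n : ℕ,
      {w | w ∈ Y ∧ dist w (TopologicalSpace.denseSeq Plane m) < 1 / ((n : ℝ) + 1) ∧
      ∀ V, IsClopenIn Y V → w ∈ V →
        ¬ V ⊆ Metric.ball (TopologicalSpace.denseSeq Plane m) (5 * (1 / ((n : ℝ) + 1)))}.Countable :=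
    fun m n => hXsus.countable_setOf_not_subset_ball hXcomp.isClosed hYX
      (fun x hx y hy hxy => hY.exists_isClopenIn hx hy hxy) _ (by positivity)
  refine ((countable_iUnion fun m => countable_iUnion fun n => hcount m n).preimage
    (f := ((↑) : Y → Plane)) Subtype.val_injective).mono ?_
  rintro x ⟨U, hU, hxU, hbad⟩
  obtain ⟨O, hO, rfl⟩ := isOpen_induced_iff.1 hU
  obtain ⟨ε, hε, hεO⟩ := Metric.isOpen_iff.1 hO x hxU
  obtain ⟨n, hn⟩ := exists_nat_one_div_lt (show 0 < ε / 6 by positivity)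
  have hr : (0 : ℝ) < 1 / ((n : ℝ) + 1) := by positivity
  obtain ⟨m, hm⟩ := Metric.denseRange_iff.1 (TopologicalSpace.denseRange_denseSeq Plane) x _ hr
  refine mem_iUnion₂.2 ⟨m, n, x.2, hm, fun V hV hxV hVball => ?_⟩
  refine hbad _ hV.isClopen_preimage hxV fun y hy => hεO ?_
  have h1 : dist (y : Plane) _ < _ := hVball hy
  rw [dist_comm] at hm
  rw [Metric.mem_ball]
  linarith [dist_triangle (y : Plane) (TopologicalSpace.denseSeq Plane m) x]
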